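/- arXiv:2511.02001 — 3 statements merged into one kernel-verified Lean document; each statement's English description precedes it below -/
import Mathlib

section
/- Let Φ and Ψ be linear flows on X = ℝ^d, and let ⋆ be any one of the symbols 0, 0⁺, 1⁻, 1, diff, lin. Then Φ and Ψ are strictly ⋆-equivalent (Φ ≈^⋆ Ψ) if and only if Φ and Ψ are ⋆-equivalent (Φ ~^⋆ Ψ). -/
noncomputable section
namespace LF

open Filter Topology

/-- `ℝ^d` with the Euclidean norm. -/
abbrev Euc (d : ℕ) := EuclideanSpace ℝ (Fin d)

variable {d : ℕ}

/-- The time-`t` map of the linear flow on `ℝ^d` generated by the matrix `A`,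
i.e. `x ↦ exp (t A) x`. -/
def linFlow (A : Matrix (Fin d) (Fin d) ℝ) (t : ℝ) (x : Euc d) : Euc d :=
  Matrix.toEuclideanLin (NormedSpace.exp (t • A)) x

/-- The orbit `{Φ_t x : t ∈ ℝ}` of `x` under the linear flow generated by `A`. -/
def flowOrbit (A : Matrix (Fin d) (Fin d) ℝ) (x : Euc d) : Set (Euc d) :=
  Set.range fun t : ℝ => linFlow A t x

/-- `Φ` is `h`-related to `Ψ`: the homeomorphism `h` maps every orbit of the flow
generated by `A` onto an orbit of the flow generated by `B`. -/
def IsOrbitEquiv (A B : Matrix (Fin d) (Fin d) ℝ) (h : Euc d ≃ₜ Euc d) : Prop :=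
  ∀ x : Euc d, h '' flowOrbit A x = flowOrbit B (h x)

/-- `f` satisfies a `β`-Hölder condition on some ball centred at `0`. -/
def HolderNearZero (β : ℝ) (f : Euc d → Euc d) : Prop :=
  ∃ r > (0 : ℝ), ∃ K : ℝ, ∀ x ∈ Metric.ball (0 : Euc d) r, ∀ y ∈ Metric.ball (0 : Euc d) r,
    dist (f x) (f y) ≤ K * dist x y ^ β

/-- `h ∈ 𝓗_β`: `h 0 = 0` and `h`, `h⁻¹` both satisfy a `β`-Hölder condition near `0`. -/
def MemHolderClass (β : ℝ) (h : Euc d ≃ₜ Euc d) : Prop :=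
  h 0 = 0 ∧ HolderNearZero β ⇑h ∧ HolderNearZero β ⇑h.symm

/-- `h ∈ 𝓗_0`: homeomorphisms fixing `0`. -/
def MemH0 (h : Euc d ≃ₜ Euc d) : Prop := h 0 = 0

/-- `h ∈ 𝓗_{0⁺} = ⋃_{γ>0} 𝓗_γ`. -/
def MemH0plus (h : Euc d ≃ₜ Euc d) : Prop := ∃ γ : ℝ, 0 < γ ∧ MemHolderClass γ h

/-- `h ∈ 𝓗_{1⁻} = ⋂_{0<γ<1} 𝓗_γ`. -/
def MemH1minus (h : Euc d ≃ₜ Euc d) : Prop := ∀ γ : ℝ, 0 < γ → γ < 1 → MemHolderClass γ h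

/-- `h ∈ 𝓗_{β⁻} = ⋂_{0<γ<β} 𝓗_γ`. -/
def MemHBelow (β : ℝ) (h : Euc d ≃ₜ Euc d) : Prop :=
  ∀ γ : ℝ, 0 < γ → γ < β → MemHolderClass γ h

/-- `h ∈ 𝓗_{β⁺} = ⋃_{γ>β} 𝓗_γ`. -/
def MemHAbove (β : ℝ) (h : Euc d ≃ₜ Euc d) : Prop :=
  ∃ γ : ℝ, β < γ ∧ MemHolderClass γ h

/-- `φ ~^⋆ ψ`: `φ` is `h`-related to `ψ` for some `h` in the class `P`. -/
def RelEquivWith (P : (Euc d ≃ₜ Euc d) → Prop) (A B : Matrix (Fin d) (Fin d) ℝ) : Prop :=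
  ∃ h : Euc d ≃ₜ Euc d, P h ∧ IsOrbitEquiv A B h

/-- `φ ≃^⋆ ψ`: there are `h` in the class `P` and `α ≠ 0` with
`h (φ t x) = ψ (α t) (h x)` for all `t`, `x`. -/
def SimEquivWith (P : (Euc d ≃ₜ Euc d) → Prop) (A B : Matrix (Fin d) (Fin d) ℝ) : Prop :=
  ∃ (h : Euc d ≃ₜ Euc d) (α : ℝ), α ≠ 0 ∧ P h ∧
    ∀ (t : ℝ) (x : Euc d), h (linFlow A t x) = linFlow B (α * t) (h x)

/-- The stable set `X_S^Φ = {x : Φ_t x → 0 as t → ∞}`. -/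
def stableSet (A : Matrix (Fin d) (Fin d) ℝ) : Set (Euc d) :=
  {x | Tendsto (fun t : ℝ => linFlow A t x) atTop (𝓝 0)}

/-- The unstable set `X_U^Φ = {x : Φ_t x → 0 as t → -∞}`. -/
def unstableSet (A : Matrix (Fin d) (Fin d) ℝ) : Set (Euc d) :=
  {x | Tendsto (fun t : ℝ => linFlow A t x) atBot (𝓝 0)}

/-- The central set `X_C^Φ = {x : e^{-ε|t|} Φ_t x → 0 as |t| → ∞, for every ε > 0}`. -/
def centralSet (A : Matrix (Fin d) (Fin d) ℝ) : Set (Euc d) :=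
  {x | ∀ ε > (0 : ℝ),
    Tendsto (fun t : ℝ => Real.exp (-(ε * |t|)) • linFlow A t x) (atBot ⊔ atTop) (𝓝 0)}

/-- The stable subspace of the flow generated by `A` (the stable set is a subspace,
so taking its span is innocuous). -/
def XS (A : Matrix (Fin d) (Fin d) ℝ) : Submodule ℝ (Euc d) := Submodule.span ℝ (stableSet A)

/-- The unstable subspace. -/
def XU (A : Matrix (Fin d) (Fin d) ℝ) : Submodule ℝ (Euc d) := Submodule.span ℝ (unstableSet A)

/-- The central subspace. -/
def XC (A : Matrix (Fin d) (Fin d) ℝ) : Submodule ℝ (Euc d) := Submodule.span ℝ (centralSet A)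

/-- The hyperbolic subspace `X_H^Φ = X_S^Φ ⊕ X_U^Φ`. -/
def XH (A : Matrix (Fin d) (Fin d) ℝ) : Submodule ℝ (Euc d) := XS A ⊔ XU A

def dimS (A : Matrix (Fin d) (Fin d) ℝ) : ℕ := Module.finrank ℝ (XS A)
def dimU (A : Matrix (Fin d) (Fin d) ℝ) : ℕ := Module.finrank ℝ (XU A)
def dimHyp (A : Matrix (Fin d) (Fin d) ℝ) : ℕ := Module.finrank ℝ (XH A)

/-- The central-part generators `A^{Φ_C}` and `α A^{Ψ_C}` are similar, i.e.
`Q A_C = (α B_C) Q` for some linear isomorphism `Q : X_C^Φ → X_C^Ψ`. -/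
def IsCentralSimilar (A B : Matrix (Fin d) (Fin d) ℝ) (α : ℝ) : Prop :=
  ∃ (hA : ∀ x ∈ XC A, Matrix.toEuclideanLin A x ∈ XC A)
    (hB : ∀ x ∈ XC B, Matrix.toEuclideanLin B x ∈ XC B)
    (Q : XC A ≃ₗ[ℝ] XC B),
    ∀ x : XC A, Q ((Matrix.toEuclideanLin A).restrict hA x)
      = α • (Matrix.toEuclideanLin B).restrict hB (Q x)

/-- The forward Lyapunov exponent `λ_+^Φ(x) = lim_{t→∞} log ‖Φ_t x‖ / t`
(the limit exists for `x ≠ 0`, so it equals the `limsup` used here). -/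
def lyap (A : Matrix (Fin d) (Fin d) ℝ) (x : Euc d) : ℝ :=
  Filter.limsup (fun t : ℝ => Real.log ‖linFlow A t x‖ / t) atTop

/-- The Lyapunov space `L^Φ(s) = {x : λ_+^Φ(x) ≤ s}` (with `λ_+^Φ(0) = -∞`), as a set. -/
def lyapSet (A : Matrix (Fin d) (Fin d) ℝ) (s : ℝ) : Set (Euc d) :=
  {x | x = 0 ∨ lyap A x ≤ s}

/-- `ℓ^Φ(s) = dim L^Φ(s)` (the Lyapunov set is a subspace, so taking its span is innocuous). -/
def ell (A : Matrix (Fin d) (Fin d) ℝ) (s : ℝ) : ℕ :=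
  Module.finrank ℝ (Submodule.span ℝ (lyapSet A s))

/-- The `(j+1)`-st smallest Lyapunov exponent `λ_{j+1}^Φ`, counted with multiplicity. -/
def lyapExp (A : Matrix (Fin d) (Fin d) ℝ) (j : ℕ) : ℝ :=
  sInf {s : ℝ | j + 1 ≤ ell A s}

/-- The Lyapunov space at `s` of the restriction of the flow to the invariant set `V`. -/
def lyapSetIn (A : Matrix (Fin d) (Fin d) ℝ) (V : Set (Euc d)) (s : ℝ) : Set (Euc d) :=
  {x | x ∈ V ∧ (x = 0 ∨ lyap A x ≤ s)}

def ellIn (A : Matrix (Fin d) (Fin d) ℝ) (V : Set (Euc d)) (s : ℝ) : ℕ :=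
  Module.finrank ℝ (Submodule.span ℝ (lyapSetIn A V s))

/-- The `(j+1)`-st smallest Lyapunov exponent of the flow restricted to `V`. -/
def lyapExpIn (A : Matrix (Fin d) (Fin d) ℝ) (V : Set (Euc d)) (j : ℕ) : ℝ :=
  sInf {s : ℝ | j + 1 ≤ ellIn A V s}

/-- `λ_{j+1}^{Φ_H}`: the `(j+1)`-st smallest Lyapunov exponent of the restriction
of the flow to the hyperbolic subspace. -/
def lyapExpH (A : Matrix (Fin d) (Fin d) ℝ) (j : ℕ) : ℝ :=
  lyapExpIn A (XH A) j

/-- The flow generated by `A` is stable: every orbit tends to `0` as `t → ∞`. -/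
def IsStable (A : Matrix (Fin d) (Fin d) ℝ) : Prop := ∀ x : Euc d, x ∈ stableSet A

/-- The flow generated by `A` is unstable: every orbit tends to `0` as `t → -∞`. -/
def IsUnstable (A : Matrix (Fin d) (Fin d) ℝ) : Prop := ∀ x : Euc d, x ∈ unstableSet A

/-- The flow generated by `A` is hyperbolic: `X = X_S ⊕ X_U`. -/
def IsHyperbolic (A : Matrix (Fin d) (Fin d) ℝ) : Prop := IsCompl (XS A) (XU A)

/-- `ρ_+(Φ,Ψ) = (min_j λ_j^Φ/λ_j^Ψ) / |max_j λ_j^Φ/λ_j^Ψ|`. -/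
def rhoPlus (A B : Matrix (Fin d) (Fin d) ℝ) : ℝ :=
  (⨅ j : Fin d, lyapExp A j / lyapExp B j) / |⨆ j : Fin d, lyapExp A j / lyapExp B j|

/-- The Lyapunov cross ratio `ρ(Φ,Ψ) = max {ρ_+(Φ,Ψ), ρ_+(Φ*,Ψ)}`, where `Φ*` is the
time-reversal of `Φ`, generated by `-A`. -/
def rho (A B : Matrix (Fin d) (Fin d) ℝ) : ℝ := max (rhoPlus A B) (rhoPlus (-A) B)

/-- The minimal period `T_x^Φ = inf {t > 0 : Φ_t x = x} ∈ [0,∞]` (with `inf ∅ = ∞`). -/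
def minPeriod (A : Matrix (Fin d) (Fin d) ℝ) (x : Euc d) : EReal :=
  sInf {T : EReal | ∃ t : ℝ, 0 < t ∧ linFlow A t x = x ∧ T = (t : EReal)}

/-- The set of complex eigenvalues of the real matrix `A`. -/
def cSpec {n : ℕ} (A : Matrix (Fin n) (Fin n) ℝ) : Set ℂ :=
  spectrum ℂ (A.map Complex.ofReal)

/-- `x` is a fixed point of the flow generated by `A`. -/
def IsFixedPt (A : Matrix (Fin d) (Fin d) ℝ) (x : Euc d) : Prop :=
  ∀ t : ℝ, linFlow A t x = x

/-- The nilpotent `m × m` Jordan block `J_m` (ones on the superdiagonal). -/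
def jordanNil (m : ℕ) : Matrix (Fin m) (Fin m) ℝ :=
  Matrix.of fun i j => if (i : ℕ) + 1 = (j : ℕ) then 1 else 0

def MemH1 (h : Euc d ≃ₜ Euc d) : Prop := MemHolderClass 1 h

/-- `h ∈ 𝓗_diff`: `h 0 = 0` and `h`, `h⁻¹` are differentiable at `0`. -/
def MemHdiff (h : Euc d ≃ₜ Euc d) : Prop :=
  h 0 = 0 ∧ DifferentiableAt ℝ ⇑h 0 ∧ DifferentiableAt ℝ ⇑h.symm 0

/-- `h ∈ 𝓗_lin`: `h` is a linear automorphism. -/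
def MemHlin (h : Euc d ≃ₜ Euc d) : Prop := IsLinearMap ℝ ⇑h

/-- `φ ≈^⋆ ψ` (strict equivalence): `φ` is `h`-related to `ψ` for some `h` in the class `P`
such that the reparametrizations `τ_x` are either increasing for every non-fixed point `x`,
or decreasing for every non-fixed point `x`. -/
def StrictRelEquivWith (P : (Euc d ≃ₜ Euc d) → Prop) (A B : Matrix (Fin d) (Fin d) ℝ) :
    Prop :=
  ∃ h : Euc d ≃ₜ Euc d, P h ∧ IsOrbitEquiv A B h ∧
    ∃ τ : Euc d → ℝ → ℝ,
      (∀ x : Euc d, ¬ IsFixedPt A x →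
        Continuous (τ x) ∧ Function.Bijective (τ x) ∧ τ x 0 = 0 ∧
          ∀ t : ℝ, h (linFlow A t x) = linFlow B (τ x t) (h x)) ∧
      ((∀ x : Euc d, ¬ IsFixedPt A x → StrictMono (τ x)) ∨
        (∀ x : Euc d, ¬ IsFixedPt A x → StrictAnti (τ x)))

/-! ### Abstract flows with local transversals -/

structure GoodFlow {X : Type*} [MetricSpace X] (φ : ℝ → X → X) : Prop where
  cont : Continuous (fun p : ℝ × X => φ p.1 p.2)
  zero : ∀ x, φ 0 x = x
  add : ∀ s t x, φ (s + t) x = φ s (φ t x)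
  box : ∀ p, ¬ (∀ t, φ t p = p) → ∃ f : X → ℝ, Continuous f ∧ ∃ δ > (0 : ℝ), ∃ W ∈ 𝓝 p,
    ∀ w ∈ W, StrictMonoOn (fun s => f (φ s w)) (Set.Icc (-(2 * δ)) (2 * δ))

theorem eq_of_countable_image {T Y : Type*} [TopologicalSpace T] [MetricSpace Y]
    {I : Set T} (hI : IsPreconnected I) {c : T → Y} (hc : ContinuousOn c I)
    {S : Set Y} (hS : S.Countable) (hcS : ∀ t ∈ I, c t ∈ S) {a b : T} (ha : a ∈ I) (hb : b ∈ I) :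
    c a = c b := by
  have h1 : IsPreconnected (c '' I) := hI.image c hc
  have h2 := hS.isTotallyDisconnected (c '' I) (by rintro _ ⟨t, ht, rfl⟩; exact hcS t ht) h1
  exact h2 ⟨a, ha, rfl⟩ ⟨b, hb, rfl⟩

theorem countable_of_sep {R : Set ℝ} {δ : ℝ} (hδ : 0 < δ)
    (h : ∀ r ∈ R, ∀ r' ∈ R, |r - r'| ≤ δ → r = r') : R.Countable := by
  refine Set.MapsTo.countable_of_injOn (f := fun r : ℝ => ⌊r / δ⌋) (t := Set.univ)
    (fun _ _ => trivial) ?_ (Set.to_countable _)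
  intro r hr r' hr' e
  apply h r hr r' hr'
  have := Int.abs_sub_lt_one_of_floor_eq_floor e
  rw [← sub_div, abs_div, abs_of_pos hδ, div_lt_one hδ] at this
  exact this.le

section
variable {X : Type*} [MetricSpace X] {φ ψ : ℝ → X → X}

theorem GoodFlow.section (hφ : GoodFlow φ) {p : X} (hp : ¬ ∀ t, φ t p = p) :
    ∃ (U : Set X) (θ : X → ℝ), IsOpen U ∧ p ∈ U ∧ ContinuousOn θ U ∧
      ∀ y, {w | ∃ z ∈ U, (∃ t, z = φ t y) ∧ w = φ (θ z) z}.Countable := by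
  obtain ⟨f, hf, δ, hδ, W, hW, hmono⟩ := hφ.box p hp
  have hc : ∀ s, Continuous (fun z => f (φ s z)) := fun s =>
    hf.comp (hφ.cont.comp (Continuous.prodMk_right s))
  have hct : ∀ z, Continuous (fun s => f (φ s z)) := fun z =>
    hf.comp (hφ.cont.comp (Continuous.prodMk_left z))
  set U : Set X := interior W ∩ ({z | f (φ (-δ) z) < f p} ∩ {z | f p < f (φ δ z)}) with hU
  have hUo : IsOpen U := isOpen_interior.inter
    ((isOpen_lt (hc _) continuous_const).inter (isOpen_lt continuous_const (hc _)))
  have hpW : p ∈ W := mem_of_mem_nhds hW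
  have hpU : p ∈ U := by
    refine ⟨mem_interior_iff_mem_nhds.2 hW, ?_, ?_⟩
    · have := hmono p hpW (a := -δ) (b := 0) ⟨by linarith, by linarith⟩ ⟨by linarith, by linarith⟩
        (by linarith)
      simpa [hφ.zero] using this
    · have := hmono p hpW (a := 0) (b := δ) ⟨by linarith, by linarith⟩ ⟨by linarith, by linarith⟩
        (by linarith)
      simpa [hφ.zero] using this
  have hUW : ∀ z ∈ U, z ∈ W := fun z hz => interior_subset hz.1
  have hex : ∀ z, ∃ s, z ∈ U → s ∈ Set.Ioo (-δ) δ ∧ f (φ s z) = f p := by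
    intro z
    by_cases hz : z ∈ U
    · obtain ⟨s, hs, e⟩ := intermediate_value_Ioo (by linarith : -δ ≤ δ) (hct z).continuousOn
        (show f p ∈ Set.Ioo _ _ from ⟨hz.2.1, hz.2.2⟩)
      exact ⟨s, fun _ => ⟨hs, e⟩⟩
    · exact ⟨0, fun h => absurd h hz⟩
  choose θ hθ using hex
  refine ⟨U, θ, hUo, hpU, ?_, ?_⟩
  · intro z0 hz0
    obtain ⟨⟨h1, h2⟩, h3⟩ := hθ z0 hz0
    refine ContinuousAt.continuousWithinAt ?_
    refine tendsto_order.2 ⟨fun a ha => ?_, fun a ha => ?_⟩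
    · have hb : max a (-δ) < θ z0 := max_lt ha h1
      have hb' : -δ ≤ max a (-δ) := le_max_right _ _
      have hlt : f (φ (max a (-δ)) z0) < f p := by
        rw [← h3]
        exact hmono z0 (hUW _ hz0) ⟨by linarith, by linarith⟩ ⟨by linarith, by linarith⟩ hb
      filter_upwards [hUo.mem_nhds hz0, (isOpen_lt (hc _) continuous_const).mem_nhds hlt]
        with z hz hlt'
      obtain ⟨⟨k1, k2⟩, k3⟩ := hθ z hz
      have hlt'' : f (φ (max a (-δ)) z) < f (φ (θ z) z) := by rw [k3]; exact hlt'
      have := ((hmono z (hUW _ hz)).lt_iff_lt ⟨by linarith, by linarith⟩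
        ⟨by linarith, by linarith⟩).1 hlt''
      exact lt_of_le_of_lt (le_max_left _ _) this
    · have hb : θ z0 < min a δ := lt_min ha h2
      have hb' : min a δ ≤ δ := min_le_right _ _
      have hlt : f p < f (φ (min a δ) z0) := by
        rw [← h3]
        exact hmono z0 (hUW _ hz0) ⟨by linarith, by linarith⟩ ⟨by linarith, by linarith⟩ hb
      filter_upwards [hUo.mem_nhds hz0, (isOpen_lt continuous_const (hc _)).mem_nhds hlt]
        with z hz hlt'
      obtain ⟨⟨k1, k2⟩, k3⟩ := hθ z hz
      have hlt'' : f (φ (θ z) z) < f (φ (min a δ) z) := by rw [k3]; exact hlt'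
      have := ((hmono z (hUW _ hz)).lt_iff_lt ⟨by linarith, by linarith⟩
        ⟨by linarith, by linarith⟩).1 hlt''
      exact lt_of_lt_of_le this (min_le_left _ _)
  · intro y
    set R : Set ℝ := {r | f (φ r y) = f p ∧
      StrictMonoOn (fun s => f (φ (s + r) y)) (Set.Icc (-δ) δ)} with hR
    have hRc : R.Countable := by
      refine countable_of_sep hδ fun r hr r' hr' hd => ?_
      have hd' := abs_le.1 hd
      have e : (fun s => f (φ (s + r) y)) 0 = (fun s => f (φ (s + r) y)) (r' - r) := by
        simp [hr.1, hr'.1]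
      have := hr.2.injOn ⟨by linarith, by linarith⟩ ⟨by linarith, by linarith⟩ e
      linarith
    refine (hRc.image (fun r => φ r y)).mono ?_
    rintro w ⟨z, hz, ⟨t, rfl⟩, rfl⟩
    obtain ⟨⟨k1, k2⟩, k3⟩ := hθ _ hz
    refine ⟨θ (φ t y) + t, ⟨?_, ?_⟩, ?_⟩
    · rw [hφ.add, k3]
    · intro a ha b hb hab
      have := hmono _ (hUW _ hz) (a := a + θ (φ t y)) (b := b + θ (φ t y))
        ⟨by linarith [ha.1], by linarith [ha.2]⟩ ⟨by linarith [hb.1], by linarith [hb.2]⟩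
        (by linarith)
      simpa [← hφ.add, add_assoc] using this
    · simp only [hφ.add]

/-- Orbit relation between flows. -/
def ORel (φ ψ : ℝ → X → X) (h : X ≃ₜ X) : Prop :=
  ∀ x, h '' (Set.range fun t => φ t x) = Set.range fun t => ψ t (h x)

theorem ORel.symm {h : X ≃ₜ X} (H : ORel φ ψ h) : ORel ψ φ h.symm := by
  intro y
  have := H (h.symm y)
  rw [h.apply_symm_apply] at this
  rw [← this, ← Set.image_comp]
  simp

theorem ORel.exists {h : X ≃ₜ X} (H : ORel φ ψ h) (t : ℝ) (x : X) :
    ∃ s, h (φ t x) = ψ s (h x) := by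
  have : h (φ t x) ∈ h '' (Set.range fun t => φ t x) := ⟨_, ⟨t, rfl⟩, rfl⟩
  rw [H x] at this
  obtain ⟨s, hs⟩ := this
  exact ⟨s, hs.symm⟩

theorem ORel.fixed {h : X ≃ₜ X} (H : ORel φ ψ h) {x : X}
    (hx : ∀ t, φ t x = x) (t : ℝ) : ψ t (h x) = h x := by
  have : ψ t (h x) ∈ Set.range fun t => ψ t (h x) := ⟨t, rfl⟩
  rw [← H x] at this
  obtain ⟨_, ⟨s, rfl⟩, e⟩ := this
  rw [← e]; simp [hx]

theorem ORel.fixed_iff {h : X ≃ₜ X} (H : ORel φ ψ h) {x : X} :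
    (∀ t, ψ t (h x) = h x) ↔ (∀ t, φ t x = x) := by
  refine ⟨fun hx => ?_, fun hx => H.fixed hx⟩
  have := H.symm.fixed hx
  simpa using this

theorem local_lift {h : X ≃ₜ X} (hφ : GoodFlow φ) (hψ : GoodFlow ψ) (H : ORel φ ψ h) {x0 : X}
    (hx0 : ¬ ∀ t, φ t x0 = x0) :
    ∃ V ∈ 𝓝 x0, ∃ ε > (0 : ℝ), ∃ σ : X → ℝ → ℝ,
      (∀ y ∈ V, ContinuousOn (σ y) (Set.Ioo (-ε) ε)) ∧
      (∀ t ∈ Set.Ioo (-ε) ε, ContinuousOn (fun y => σ y t) V) ∧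
      (∀ y ∈ V, σ y 0 = 0) ∧
      (∀ y ∈ V, ∀ t ∈ Set.Ioo (-ε) ε, h (φ t y) = ψ (σ y t) (h y)) := by
  obtain ⟨U, θ, hUo, hpU, hθ, hcount⟩ := hψ.section (p := h x0)
    (fun hh => hx0 ((H.fixed_iff).1 hh))
  have hcontJ : Continuous (fun p : ℝ × X => h (φ p.1 p.2)) := h.continuous.comp hφ.cont
  have hnear : (fun p : ℝ × X => h (φ p.1 p.2)) ⁻¹' U ∈ 𝓝 ((0 : ℝ), x0) := by
    refine hcontJ.continuousAt.preimage_mem_nhds (hUo.mem_nhds ?_)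
    simpa [hφ.zero] using hpU
  rw [nhds_prod_eq] at hnear
  obtain ⟨I, hI, V, hV, hIV⟩ := Filter.mem_prod_iff.1 hnear
  obtain ⟨ε, hε, hεI⟩ := Metric.mem_nhds_iff.1 hI
  rw [Real.ball_eq_Ioo, zero_sub, zero_add] at hεI
  have hin : ∀ y ∈ V, ∀ t ∈ Set.Ioo (-ε) ε, h (φ t y) ∈ U := fun y hy t ht =>
    hIV (Set.mk_mem_prod (hεI ht) hy)
  have h0 : (0 : ℝ) ∈ Set.Ioo (-ε) ε := ⟨by linarith, hε⟩
  have hin0 : ∀ y ∈ V, h y ∈ U := fun y hy => by simpa [hφ.zero] using hin y hy 0 h0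
  have hc1 : ∀ y, Continuous fun t => h (φ t y) := fun y =>
    hcontJ.comp (Continuous.prodMk_left y)
  have hc2 : ∀ t, Continuous fun y => h (φ t y) := fun t =>
    hcontJ.comp (Continuous.prodMk_right t)
  refine ⟨V, hV, ε, hε, fun y t => θ (h y) - θ (h (φ t y)), ?_, ?_, ?_, ?_⟩
  · intro y hy
    exact continuousOn_const.sub (hθ.comp (hc1 y).continuousOn (fun t ht => hin y hy t ht))
  · intro t ht
    exact (hθ.comp h.continuous.continuousOn (fun y hy => hin0 y hy)).sub
      (hθ.comp (hc2 t).continuousOn (fun y hy => hin y hy t ht))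
  · intro y _; simp [hφ.zero]
  · intro y hy t ht
    have key := eq_of_countable_image (I := Set.Ioo (-ε) ε) isPreconnected_Ioo
      (c := fun t => ψ (θ (h (φ t y))) (h (φ t y)))
      (hψ.cont.comp_continuousOn
        ((hθ.comp (hc1 y).continuousOn (fun t ht => hin y hy t ht)).prodMk (hc1 y).continuousOn))
      (hcount (h y))
      (fun t ht => ⟨h (φ t y), hin y hy t ht, H.exists t y, rfl⟩) ht h0
    simp only [hφ.zero] at key
    have := congrArg (ψ (-θ (h (φ t y)))) key
    rw [← hψ.add, ← hψ.add, neg_add_cancel, hψ.zero] at this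
    rw [this]; congr 1; ring

/-- The group of periods. -/
def periodGroup (hφ : GoodFlow φ) (x : X) : AddSubgroup ℝ where
  carrier := {t | φ t x = x}
  zero_mem' := hφ.zero x
  add_mem' := by
    intro a b ha hb
    change φ (a + b) x = x
    rw [hφ.add, hb, ha]
  neg_mem' := by
    intro a ha
    change φ (-a) x = x
    conv_lhs => rw [← (ha : φ a x = x)]
    rw [← hφ.add, neg_add_cancel, hφ.zero]

theorem mem_periodGroup (hφ : GoodFlow φ) {x : X} {t : ℝ} :
    t ∈ periodGroup hφ x ↔ φ t x = x := Iff.rfl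

theorem eq_iff_period (hφ : GoodFlow φ) {x : X} {s t : ℝ} :
    φ s x = φ t x ↔ -s + t ∈ periodGroup hφ x := by
  rw [mem_periodGroup, hφ.add]
  constructor
  · intro e; rw [← e, ← hφ.add, neg_add_cancel, hφ.zero]
  · intro e
    have := congrArg (φ s) e
    rw [← hφ.add, add_neg_cancel, hφ.zero] at this
    exact this.symm

theorem periodGroup_cyclic (hφ : GoodFlow φ) {x : X} (hx : ¬ ∀ t, φ t x = x) :
    ∃ a, periodGroup hφ x = AddSubgroup.closure {a} := by
  rcases (periodGroup hφ x).dense_or_cyclic with h | h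
  · exfalso
    have hcl : IsClosed ((periodGroup hφ x : AddSubgroup ℝ) : Set ℝ) :=
      isClosed_eq (hφ.cont.comp (Continuous.prodMk_left x)) continuous_const
    have := hcl.closure_eq ▸ h.closure_eq
    exact hx fun t => (by rw [this]; trivial : t ∈ ((periodGroup hφ x : AddSubgroup ℝ) : Set ℝ))
  · exact h

theorem periodGroup_countable (hφ : GoodFlow φ) {x : X} (hx : ¬ ∀ t, φ t x = x) :
    ((periodGroup hφ x : AddSubgroup ℝ) : Set ℝ).Countable := by
  obtain ⟨a, ha⟩ := periodGroup_cyclic hφ hx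
  rw [ha, ← AddSubgroup.zmultiples_eq_closure]
  exact Set.countable_range _

theorem periodGroup_discrete (hφ : GoodFlow φ) {x : X} (hx : ¬ ∀ t, φ t x = x) :
    DiscreteTopology (periodGroup hφ x) := by
  obtain ⟨a, ha⟩ := periodGroup_cyclic hφ hx
  rw [ha, ← AddSubgroup.zmultiples_eq_closure]
  infer_instance

/-- Two continuous lifts on a preconnected set agreeing at one point agree. -/
theorem lift_unique (hφ : GoodFlow φ) {x : X} (hx : ¬ ∀ t, φ t x = x) {I : Set ℝ}
    (hI : IsPreconnected I) {a b : ℝ → ℝ} (ha : ContinuousOn a I) (hb : ContinuousOn b I)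
    (hab : ∀ t ∈ I, φ (a t) x = φ (b t) x) {t0 t : ℝ} (ht0 : t0 ∈ I) (h0 : a t0 = b t0)
    (ht : t ∈ I) : a t = b t := by
  have := eq_of_countable_image hI (c := fun t => -a t + b t) (ha.neg.add hb)
    (periodGroup_countable hφ hx) (fun t ht => (eq_iff_period hφ).1 (hab t ht)) ht ht0
  simp only [h0, neg_add_cancel] at this
  linarith

theorem exists_lift {h : X ≃ₜ X} (hφ : GoodFlow φ) (hψ : GoodFlow ψ) (H : ORel φ ψ h) {x : X}
    (hx : ¬ ∀ t, φ t x = x) :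
    ∃ τ : ℝ → ℝ, Continuous τ ∧ τ 0 = 0 ∧ ∀ t, h (φ t x) = ψ (τ t) (h x) := by
  have hy : ¬ ∀ t, ψ t (h x) = h x := fun hh => hx ((H.fixed_iff).1 hh)
  set G := periodGroup hψ (h x) with hG
  have : DiscreteTopology G := periodGroup_discrete hψ hy
  choose τ0 hτ0 using fun t => H.exists t x
  have hcont : Continuous (fun t => (τ0 t : ℝ ⧸ G)) := by
    rw [continuous_iff_continuousAt]
    intro t0
    have hxt : ¬ ∀ t, φ t (φ t0 x) = φ t0 x := by
      intro hh
      apply hx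
      intro t
      have h1 := hh (-t0)
      rw [← hφ.add, neg_add_cancel, hφ.zero] at h1
      rw [← h1] at hh; exact hh t
    obtain ⟨V, hV, ε, hε, σ, hσ, -, hσ0, hσe⟩ := local_lift hφ hψ H hxt
    have hm := mem_of_mem_nhds hV
    have h0 : (0 : ℝ) ∈ Set.Ioo (-ε) ε := ⟨by linarith, hε⟩
    have hev : (fun t => (τ0 t : ℝ ⧸ G)) =ᶠ[𝓝 t0]
        fun t => ((τ0 t0 + σ (φ t0 x) (t - t0) : ℝ) : ℝ ⧸ G) := by
      have : Set.Ioo (t0 - ε) (t0 + ε) ∈ 𝓝 t0 := Ioo_mem_nhds (by linarith) (by linarith)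
      filter_upwards [this] with t ht
      have e := hσe _ hm (t - t0) ⟨by linarith [ht.1], by linarith [ht.2]⟩
      rw [← hφ.add, sub_add_cancel, hτ0, hτ0, ← hψ.add] at e
      rw [QuotientAddGroup.eq, add_comm (τ0 t0)]
      exact (eq_iff_period hψ).1 e
    refine ContinuousAt.congr ?_ hev.symm
    refine (QuotientAddGroup.continuous_mk (N := G)).continuousAt.comp ?_
    refine continuousAt_const.add ?_
    have hc : ContinuousAt (σ (φ t0 x)) (t0 - t0) := by
      rw [sub_self]
      exact (hσ _ hm).continuousAt (isOpen_Ioo.mem_nhds h0)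
    exact ContinuousAt.comp (f := fun t => t - t0) hc (by fun_prop)
  have hcov : IsCoveringMap (QuotientAddGroup.mk : ℝ → ℝ ⧸ G) :=
    (AddSubgroup.isAddQuotientCoveringMap_of_comm G
      (by rw [SetLike.isDiscrete_iff_discreteTopology]; infer_instance)).isCoveringMap
  obtain ⟨F, ⟨hF0, hF⟩, -⟩ := hcov.existsUnique_continuousMap_lifts
    (⟨_, hcont⟩ : C(ℝ, ℝ ⧸ G)) 0 0 (by
      simp only [ContinuousMap.coe_mk]
      rw [QuotientAddGroup.eq]
      refine (eq_iff_period hψ).1 ?_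
      rw [← hτ0, hφ.zero, hψ.zero])
  refine ⟨F, F.continuous, hF0, fun t => ?_⟩
  have := congrFun hF t
  simp only [Function.comp, ContinuousMap.coe_mk] at this
  rw [QuotientAddGroup.eq] at this
  rw [hτ0]
  exact ((eq_iff_period hψ).2 this).symm

theorem exists_bij_lift {h : X ≃ₜ X} (hφ : GoodFlow φ) (hψ : GoodFlow ψ) (H : ORel φ ψ h) {x : X}
    (hx : ¬ ∀ t, φ t x = x) :
    ∃ τ : ℝ → ℝ, Continuous τ ∧ Function.Bijective τ ∧ τ 0 = 0 ∧
      ∀ t, h (φ t x) = ψ (τ t) (h x) := by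
  have hy : ¬ ∀ t, ψ t (h x) = h x := fun hh => hx ((H.fixed_iff).1 hh)
  obtain ⟨τ, hτ, hτ0, hτe⟩ := exists_lift hφ hψ H hx
  obtain ⟨ρ, hρ, hρ0, hρe⟩ := exists_lift hψ hφ H.symm hy
  simp only [h.symm_apply_apply] at hρe
  have h1 : ∀ t, ρ (τ t) = t := fun t =>
    lift_unique hφ hx isPreconnected_univ (a := fun t => ρ (τ t)) (b := fun t => t)
      (hρ.comp hτ).continuousOn continuous_id.continuousOn
      (fun t _ => by rw [← hρe, ← hτe, h.symm_apply_apply]) (t0 := 0) trivial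
      (by simp [hτ0, hρ0]) trivial
  have h2 : ∀ t, τ (ρ t) = t := fun t =>
    lift_unique hψ hy isPreconnected_univ (a := fun t => τ (ρ t)) (b := fun t => t)
      (hτ.comp hρ).continuousOn continuous_id.continuousOn
      (fun t _ => by rw [← hτe, ← hρe, h.apply_symm_apply]) (t0 := 0) trivial
      (by simp [hτ0, hρ0]) trivial
  exact ⟨τ, hτ, Function.bijective_iff_has_inverse.2 ⟨ρ, h1, h2⟩, hτ0, hτe⟩

/-- If the set of non-fixed points is preconnected, all reparametrizations have the
same direction. -/
theorem sign_const {h : X ≃ₜ X} (hφ : GoodFlow φ) (hψ : GoodFlow ψ) (H : ORel φ ψ h)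
    (hconn : IsPreconnected {x | ¬ ∀ t, φ t x = x}) :
    ∃ τ : X → ℝ → ℝ,
      (∀ x, (¬ ∀ t, φ t x = x) → Continuous (τ x) ∧ Function.Bijective (τ x) ∧ τ x 0 = 0 ∧
          ∀ t : ℝ, h (φ t x) = ψ (τ x t) (h x)) ∧
      ((∀ x, (¬ ∀ t, φ t x = x) → StrictMono (τ x)) ∨
        (∀ x, (¬ ∀ t, φ t x = x) → StrictAnti (τ x))) := by
  have hex : ∀ x, ∃ τ : ℝ → ℝ, (¬ ∀ t, φ t x = x) → Continuous τ ∧ Function.Bijective τ ∧ τ 0 = 0 ∧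
      ∀ t, h (φ t x) = ψ (τ t) (h x) := by
    intro x
    by_cases hx : ∀ t, φ t x = x
    · exact ⟨id, fun hh => absurd hx hh⟩
    · obtain ⟨τ, hτ⟩ := exists_bij_lift hφ hψ H hx
      exact ⟨τ, fun _ => hτ⟩
  choose τ hτ using hex
  refine ⟨τ, hτ, ?_⟩
  set N := {x | ¬ ∀ t, φ t x = x} with hN
  have hNo : IsOpen N := by
    have : N = ⋃ t, {x | φ t x ≠ x} := by ext; simp [hN]
    rw [this]
    exact isOpen_iUnion fun t =>
      isOpen_ne_fun (hφ.cont.comp (Continuous.prodMk_right t)) continuous_id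
  -- positivity is independent of time
  have hdich : ∀ x ∈ N, StrictMono (τ x) ∨ StrictAnti (τ x) := fun x hx =>
    (hτ x hx).1.strictMono_of_inj (hτ x hx).2.1.injective
  have hmono : ∀ x ∈ N, ∀ t > 0, (0 < τ x t ↔ StrictMono (τ x)) := by
    intro x hx t ht
    constructor
    · intro h0
      rcases hdich x hx with h' | h'
      · exact h'
      · have := h' ht; rw [(hτ x hx).2.2.1] at this; linarith
    · intro h'
      have := h' ht; rw [(hτ x hx).2.2.1] at this; exact this
  have hanti : ∀ x ∈ N, ∀ t > 0, (τ x t < 0 ↔ StrictAnti (τ x)) := by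
    intro x hx t ht
    constructor
    · intro h0
      rcases hdich x hx with h' | h'
      · have := h' ht; rw [(hτ x hx).2.2.1] at this; linarith
      · exact h'
    · intro h'
      have := h' ht; rw [(hτ x hx).2.2.1] at this; exact this
  -- local continuity of `τ y t0`
  have hloc : ∀ x ∈ N, ∃ t0 > (0 : ℝ), ContinuousAt (fun y => τ y t0) x := by
    intro x hx
    obtain ⟨V, hV, ε, hε, σ, hσ1, hσ2, hσ0, hσe⟩ := local_lift hφ hψ H hx
    have ht : ε / 2 ∈ Set.Ioo (-ε) ε := ⟨by linarith, by linarith⟩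
    refine ⟨ε / 2, by positivity, ?_⟩
    have hc := (hσ2 _ ht).continuousAt hV
    refine hc.congr ?_
    filter_upwards [hV, hNo.mem_nhds hx] with y hyV hyN
    have hy : ¬ ∀ t, ψ t (h y) = h y := fun hh => hyN ((H.fixed_iff).1 hh)
    exact lift_unique hψ hy isPreconnected_Ioo (hσ1 y hyV) (hτ y hyN).1.continuousOn
      (fun t ht => by rw [← hσe y hyV t ht, (hτ y hyN).2.2.2]) (t0 := 0)
      ⟨by linarith, hε⟩ (by rw [hσ0 y hyV, (hτ y hyN).2.2.1]) ht
  have hPo : IsOpen {x | x ∈ N ∧ StrictMono (τ x)} := by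
    rw [isOpen_iff_mem_nhds]
    rintro x ⟨hx, hm⟩
    obtain ⟨t0, ht0, hc⟩ := hloc x hx
    filter_upwards [hNo.mem_nhds hx, hc.eventually_const_lt ((hmono x hx t0 ht0).2 hm)] with y hy hl
    exact ⟨hy, (hmono y hy t0 ht0).1 hl⟩
  have hMo : IsOpen {x | x ∈ N ∧ StrictAnti (τ x)} := by
    rw [isOpen_iff_mem_nhds]
    rintro x ⟨hx, hm⟩
    obtain ⟨t0, ht0, hc⟩ := hloc x hx
    filter_upwards [hNo.mem_nhds hx, hc.eventually_lt_const ((hanti x hx t0 ht0).2 hm)] with y hy hl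
    exact ⟨hy, (hanti y hy t0 ht0).1 hl⟩
  by_contra hcon
  push Not at hcon
  obtain ⟨⟨x, hx, hx'⟩, ⟨y, hy, hy'⟩⟩ := hcon
  obtain ⟨z, hz, hz1, hz2⟩ := hconn _ _ hPo hMo
    (fun x hx => (hdich x hx).imp (fun h => ⟨hx, h⟩) (fun h => ⟨hx, h⟩))
    ⟨y, by simpa [hN] using hy, by simpa [hN] using hy, (hdich y (by simpa [hN] using hy)).resolve_right hy'⟩
    ⟨x, by simpa [hN] using hx, by simpa [hN] using hx, (hdich x (by simpa [hN] using hx)).resolve_left hx'⟩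
  have a := hz1.2 zero_lt_one
  have b := hz2.2 zero_lt_one
  linarith

end

/-! ### Linear flows -/

section
open scoped Matrix.Norms.Operator

theorem linFlow_hasDerivAt (A : Matrix (Fin d) (Fin d) ℝ) (x : Euc d) (t : ℝ) :
    HasDerivAt (fun s => linFlow A s x) (Matrix.toEuclideanLin A (linFlow A t x)) t := by
  have h1 : HasDerivAt (fun u : ℝ => NormedSpace.exp (u • A)) (A * NormedSpace.exp (t • A)) t :=
    hasDerivAt_exp_smul_const' A t
  let E : Matrix (Fin d) (Fin d) ℝ →ₗ[ℝ] Euc d :=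
    (LinearMap.applyₗ x).comp (Matrix.toEuclideanLin (𝕜 := ℝ) (m := Fin d) (n := Fin d)).toLinearMap
  have h2 := (LinearMap.toContinuousLinearMap E).hasFDerivAt.comp_hasDerivAt t h1
  have e : (LinearMap.toContinuousLinearMap E) (A * NormedSpace.exp (t • A)) =
      Matrix.toEuclideanLin A (linFlow A t x) := by
    simp [E, linFlow, Matrix.toLpLin_apply, Matrix.mulVec_mulVec]
  exact HasDerivAt.congr_deriv h2 e

theorem linFlow_continuous (A : Matrix (Fin d) (Fin d) ℝ) :
    Continuous (fun p : ℝ × Euc d => linFlow A p.1 p.2) := by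
  have h1 : Continuous (fun u : ℝ => NormedSpace.exp (u • A)) :=
    continuous_iff_continuousAt.2 fun t => (hasDerivAt_exp_smul_const' A t).continuousAt
  have h2 : Continuous (fun M : Matrix (Fin d) (Fin d) ℝ =>
      LinearMap.toContinuousLinearMap (Matrix.toEuclideanLin M)) :=
    LinearMap.continuous_of_finiteDimensional
      ((LinearMap.toContinuousLinearMap (𝕜 := ℝ) (E := Euc d) (F' := Euc d)).toLinearMap.comp
      (Matrix.toEuclideanLin (𝕜 := ℝ) (m := Fin d) (n := Fin d)).toLinearMap)
  exact ((h2.comp h1).comp continuous_fst).clm_apply continuous_snd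

end

theorem linFlow_zero (A : Matrix (Fin d) (Fin d) ℝ) (x : Euc d) : linFlow A 0 x = x := by
  simp [linFlow]

theorem linFlow_add (A : Matrix (Fin d) (Fin d) ℝ) (s t : ℝ) (x : Euc d) :
    linFlow A (s + t) x = linFlow A s (linFlow A t x) := by
  unfold linFlow
  rw [add_smul, Matrix.exp_add_of_commute _ _
    (((Commute.refl A).smul_left s).smul_right t)]
  simp [Matrix.toLpLin_apply, Matrix.mulVec_mulVec]

theorem linFlow_unique (A : Matrix (Fin d) (Fin d) ℝ) {y : ℝ → Euc d}
    (hy : ∀ t, HasDerivAt y (Matrix.toEuclideanLin A (y t)) t) (t : ℝ) :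
    y t = linFlow A t (y 0) := by
  have := ODE_solution_unique_univ (v := fun _ => Matrix.toEuclideanLin A) (s := fun _ => Set.univ)
    (K := ‖LinearMap.toContinuousLinearMap (Matrix.toEuclideanLin A)‖₊) (t₀ := 0)
    (f := y) (g := fun t => linFlow A t (y 0))
    (fun t => ((LinearMap.toContinuousLinearMap
      (Matrix.toEuclideanLin A)).lipschitz).lipschitzOnWith)
    (fun t => ⟨hy t, trivial⟩) (fun t => ⟨linFlow_hasDerivAt A _ t, trivial⟩)
    (by simp [linFlow_zero])
  exact congrFun this t

theorem isFixedPt_iff (A : Matrix (Fin d) (Fin d) ℝ) (x : Euc d) :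
    IsFixedPt A x ↔ Matrix.toEuclideanLin A x = 0 := by
  constructor
  · intro h
    have h1 := linFlow_hasDerivAt A x 0
    have h2 : (fun s => linFlow A s x) = fun _ => x := funext h
    rw [linFlow_zero, h2] at h1
    exact h1.unique (hasDerivAt_const 0 x)
  · intro h t
    have := linFlow_unique A (y := fun _ => x) (fun t => by rw [h]; exact hasDerivAt_const t x) t
    exact this.symm

theorem linFlow_box (A : Matrix (Fin d) (Fin d) ℝ) (p : Euc d) (hp : ¬ ∀ t, linFlow A t p = p) :
    ∃ f : Euc d → ℝ, Continuous f ∧ ∃ δ > (0 : ℝ), ∃ W ∈ 𝓝 p,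
    ∀ w ∈ W, StrictMonoOn (fun s => f (linFlow A s w)) (Set.Icc (-(2 * δ)) (2 * δ)) := by
  have hp' : Matrix.toEuclideanLin A p ≠ 0 := fun h => hp ((isFixedPt_iff A p).2 h)
  obtain ⟨f, hf⟩ := SeparatingDual.exists_eq_one (R := ℝ) hp'
  have hT : Continuous (Matrix.toEuclideanLin A) := LinearMap.continuous_of_finiteDimensional _
  have hg : Continuous (fun z : ℝ × Euc d => f (Matrix.toEuclideanLin A (linFlow A z.1 z.2))) :=
    f.continuous.comp (hT.comp (linFlow_continuous A))
  have hev : ∀ᶠ z in 𝓝 ((0 : ℝ), p), 0 < f (Matrix.toEuclideanLin A (linFlow A z.1 z.2)) := by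
    refine hg.continuousAt.eventually_const_lt ?_
    simp only [linFlow_zero, hf, zero_lt_one]
  rw [nhds_prod_eq] at hev
  obtain ⟨pI, hI, pW, hW, hIW⟩ := Filter.eventually_prod_iff.1 hev
  obtain ⟨ε, hε, hεI⟩ := Metric.eventually_nhds_iff.1 hI
  refine ⟨f, f.continuous, ε / 4, by positivity, {w | pW w}, hW, fun w hw => ?_⟩
  have hd : ∀ s, HasDerivAt (fun s => f (linFlow A s w))
      (f (Matrix.toEuclideanLin A (linFlow A s w))) s := fun s =>
    f.hasFDerivAt.comp_hasDerivAt s (linFlow_hasDerivAt A w s)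
  refine strictMonoOn_of_deriv_pos (convex_Icc _ _)
    (continuous_iff_continuousAt.2 fun s => (hd s).continuousAt).continuousOn fun s hs => ?_
  rw [(hd s).deriv]
  rw [interior_Icc] at hs
  have hs' : dist s 0 < ε := by
    rw [Real.dist_eq, sub_zero, abs_lt]
    exact ⟨by linarith [hs.1], by linarith [hs.2]⟩
  exact hIW (hεI hs') hw

theorem goodFlow_linFlow (A : Matrix (Fin d) (Fin d) ℝ) : GoodFlow (linFlow A) where
  cont := linFlow_continuous A
  zero := linFlow_zero A
  add := linFlow_add A
  box := linFlow_box A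

theorem linFlow_intertwine {A B : Matrix (Fin d) (Fin d) ℝ} (Q : Euc d →ₗ[ℝ] Euc d) {α : ℝ}
    (hQ : ∀ x, Q (Matrix.toEuclideanLin A x) = α • Matrix.toEuclideanLin B (Q x))
    (hα : α ≠ 0) (t : ℝ) (x : Euc d) : Q (linFlow A t x) = linFlow B (α * t) (Q x) := by
  have h := linFlow_unique B (y := fun s => Q (linFlow A (α⁻¹ * s) x)) (fun s => by
    have h1 := (linFlow_hasDerivAt A x (α⁻¹ * s)).scomp s ((hasDerivAt_id s).const_mul α⁻¹)
    have h2 := (LinearMap.toContinuousLinearMap Q).hasFDerivAt.comp_hasDerivAt s h1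
    have e : (LinearMap.toContinuousLinearMap Q) ((α⁻¹ * 1) •
        Matrix.toEuclideanLin A (linFlow A (α⁻¹ * s) x)) =
        Matrix.toEuclideanLin B (Q (linFlow A (α⁻¹ * s) x)) := by
      simp [hQ, smul_smul, inv_mul_cancel₀ hα]
    rw [e] at h2
    exact h2) (α * t)
  simpa [linFlow_zero, inv_mul_cancel_left₀ hα] using h

theorem linFlow_eigen {A : Matrix (Fin d) (Fin d) ℝ} {w : Euc d} {c : ℝ}
    (hw : Matrix.toEuclideanLin A w = c • w) (t : ℝ) :
    linFlow A t w = Real.exp (c * t) • w := by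
  have h := linFlow_unique A (y := fun s => Real.exp (c * s) • w) (fun s => by
    have h1 := (((hasDerivAt_id s).const_mul c).exp).smul_const w
    exact HasDerivAt.congr_deriv h1 (by simp [hw, smul_smul, mul_comm])) t
  simpa using h.symm

theorem linFlow_map_add (A : Matrix (Fin d) (Fin d) ℝ) (t : ℝ) (x y : Euc d) :
    linFlow A t (x + y) = linFlow A t x + linFlow A t y := by simp [linFlow]

/-- Linear equivalences lie in all classes. -/
theorem holder_linear (Q : Euc d →L[ℝ] Euc d) {γ : ℝ} (h0 : 0 < γ) (h1 : γ ≤ 1) :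
    HolderNearZero γ Q := by
  refine ⟨1 / 2, by norm_num, ‖Q‖, fun x hx y hy => ?_⟩
  rw [mem_ball_zero_iff] at hx hy
  have hd : dist x y ≤ 1 := by
    rw [dist_eq_norm]; linarith [norm_sub_le x y]
  have hle : dist x y ≤ dist x y ^ γ := by
    conv_lhs => rw [← Real.rpow_one (dist x y)]
    rcases eq_or_lt_of_le (dist_nonneg (x := x) (y := y)) with h | h
    · rw [← h, Real.zero_rpow h0.ne', Real.zero_rpow one_ne_zero]
    · exact Real.rpow_le_rpow_of_exponent_ge h hd h1
  calc dist (Q x) (Q y) ≤ ‖Q‖ * dist x y := by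
        rw [dist_eq_norm, dist_eq_norm, ← map_sub]; exact Q.le_opNorm _
    _ ≤ _ := by gcongr

theorem linear_mem (P : (Euc d ≃ₜ Euc d) → Prop)
    (hP : P = @MemH0 d ∨ P = @MemH0plus d ∨ P = @MemH1minus d ∨ P = @MemH1 d ∨
      P = @MemHdiff d ∨ P = @MemHlin d) (Q : Euc d ≃L[ℝ] Euc d) : P Q.toHomeomorph := by
  have hH : ∀ γ : ℝ, 0 < γ → γ ≤ 1 → MemHolderClass γ Q.toHomeomorph := fun γ h0 h1 =>
    ⟨map_zero Q, holder_linear (Q : Euc d →L[ℝ] Euc d) h0 h1,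
      holder_linear (Q.symm : Euc d →L[ℝ] Euc d) h0 h1⟩
  rcases hP with rfl | rfl | rfl | rfl | rfl | rfl
  · exact map_zero Q
  · exact ⟨1, one_pos, hH 1 one_pos le_rfl⟩
  · exact fun γ h0 h1 => hH γ h0 h1.le
  · exact hH 1 one_pos le_rfl
  · exact ⟨map_zero Q, Q.differentiableAt, Q.symm.differentiableAt⟩
  · exact ⟨map_add Q, map_smul Q⟩

theorem strict_of_linear {A B : Matrix (Fin d) (Fin d) ℝ} (P : (Euc d ≃ₜ Euc d) → Prop)
    (hP : P = @MemH0 d ∨ P = @MemH0plus d ∨ P = @MemH1minus d ∨ P = @MemH1 d ∨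
      P = @MemHdiff d ∨ P = @MemHlin d) (Q : Euc d →ₗ[ℝ] Euc d) (hinj : Function.Injective Q)
    {α : ℝ} (hα : α ≠ 0)
    (hQ : ∀ x, Q (Matrix.toEuclideanLin A x) = α • Matrix.toEuclideanLin B (Q x)) :
    StrictRelEquivWith P A B := by
  let Q' : Euc d ≃L[ℝ] Euc d := (LinearEquiv.ofInjectiveEndo Q hinj).toContinuousLinearEquiv
  have hintw : ∀ t x, Q'.toHomeomorph (linFlow A t x) = linFlow B (α * t) (Q'.toHomeomorph x) :=
    linFlow_intertwine Q hQ hα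
  refine ⟨Q'.toHomeomorph, linear_mem P hP Q', ?_, fun _ t => α * t, ?_, ?_⟩
  · intro x
    ext z
    simp only [flowOrbit, Set.mem_image, Set.mem_range, exists_exists_eq_and, hintw]
    constructor
    · rintro ⟨t, rfl⟩; exact ⟨α * t, rfl⟩
    · rintro ⟨t, rfl⟩; exact ⟨α⁻¹ * t, by rw [mul_inv_cancel_left₀ hα]⟩
  · intro x _
    exact ⟨by fun_prop, (Equiv.mulLeft₀ α hα).bijective, by simp, fun t => hintw t x⟩
  · rcases lt_or_gt_of_ne hα with h | h
    · exact Or.inr fun x _ => strictAnti_mul_left h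
    · exact Or.inl fun x _ => strictMono_mul_left_of_pos h

/-- Either the set of non-fixed points is preconnected, or `A` has rank one. -/
theorem preconnected_or_rank_one (A : Matrix (Fin d) (Fin d) ℝ) :
    IsPreconnected {x | ¬ ∀ t, linFlow A t x = x} ∨
    ∃ (u : Euc d) (v : Euc d →ₗ[ℝ] ℝ), u ≠ 0 ∧ v ≠ 0 ∧
      ∀ x, Matrix.toEuclideanLin A x = v x • u := by
  set T := Matrix.toEuclideanLin A with hT
  have hset : {x | ¬ ∀ t, linFlow A t x = x} = ((LinearMap.ker T : Submodule ℝ (Euc d)) : Set _)ᶜ := by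
    ext x
    simp only [Set.mem_ofPred_eq, Set.mem_compl_iff, SetLike.mem_coe, LinearMap.mem_ker]
    exact not_congr (isFixedPt_iff A x)
  rw [hset]
  have hr : Module.rank ℝ (Euc d ⧸ LinearMap.ker T) = Module.finrank ℝ (LinearMap.range T) := by
    rw [(T.quotKerEquivRange).rank_eq, Module.finrank_eq_rank]
  rcases lt_trichotomy (Module.finrank ℝ (LinearMap.range T)) 1 with h | h | h
  · left
    have h0 : Module.finrank ℝ (LinearMap.range T) = 0 := by omega
    rw [Submodule.finrank_eq_zero, LinearMap.range_eq_bot] at h0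
    rw [h0]
    simp [isPreconnected_empty]
  · right
    obtain ⟨⟨u, hu⟩, hu0, hall⟩ := finrank_eq_one_iff'.1 h
    have hu0' : u ≠ 0 := fun h => hu0 (Subtype.ext h)
    have hall' : ∀ x, ∃ c : ℝ, c • u = T x := fun x => by
      obtain ⟨c, hc⟩ := hall ⟨T x, LinearMap.mem_range_self T x⟩
      exact ⟨c, congrArg Subtype.val hc⟩
    choose c hc using hall'
    obtain ⟨f, hf⟩ := SeparatingDual.exists_eq_one (R := ℝ) hu0'
    have hv : ∀ x, T x = (f.toLinearMap.comp T) x • u := fun x => by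
      simp [← hc x, hf]
    refine ⟨u, f.toLinearMap.comp T, hu0', ?_, hv⟩
    intro hv0
    obtain ⟨x, hx⟩ := hu
    rw [hv x, hv0] at hx
    exact hu0' (by simpa using hx.symm)
  · left
    refine (isConnected_compl_of_one_lt_codim ?_).isPreconnected
    rw [hr]; exact_mod_cast h

theorem exists_ne_ne {V : Type*} [AddCommGroup V] [Module ℝ V] {f g : V →ₗ[ℝ] ℝ}
    (hf : f ≠ 0) (hg : g ≠ 0) : ∃ w, f w ≠ 0 ∧ g w ≠ 0 := by
  obtain ⟨a, ha⟩ : ∃ a, f a ≠ 0 := by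
    by_contra h; push Not at h; exact hf (LinearMap.ext h)
  obtain ⟨b, hb⟩ : ∃ b, g b ≠ 0 := by
    by_contra h; push Not at h; exact hg (LinearMap.ext h)
  by_cases ha' : g a = 0
  · by_cases hb' : f b = 0
    · exact ⟨a + b, by simpa [hb'] using ha, by simpa [ha'] using hb⟩
    · exact ⟨b, hb', hb⟩
  · exact ⟨a, ha, ha'⟩

/-- Linear conjugacy of rank-one pairs. -/
theorem exists_conj {u u' : Euc d} {v v' : Euc d →ₗ[ℝ] ℝ} (hu : u ≠ 0) (hu' : u' ≠ 0)
    (hv : v ≠ 0) (hv' : v' ≠ 0) (hz : v u = 0 ↔ v' u' = 0) :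
    ∃ (Q : Euc d →ₗ[ℝ] Euc d) (c : ℝ), Function.Injective Q ∧ c ≠ 0 ∧ Q u = c • u' ∧
      ∀ x, v' (Q x) = v x := by
  obtain ⟨c, hc, hcv⟩ : ∃ c : ℝ, c ≠ 0 ∧ v' (c • u') = v u := by
    by_cases h : v u = 0
    · exact ⟨1, one_ne_zero, by simp [h, hz.1 h]⟩
    · have h' : v' u' ≠ 0 := fun h' => h (hz.2 h')
      exact ⟨v u / v' u', div_ne_zero h h', by simp [div_mul_cancel₀ _ h']⟩
  obtain ⟨w, hw, hw'⟩ := exists_ne_ne hv hv'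
  -- first map: `v' ∘ Q1 = v`
  let Q1 : Euc d →ₗ[ℝ] Euc d := LinearMap.id + ((v' w)⁻¹ • (v - v')).smulRight w
  have hQ1 : ∀ x, Q1 x = x + ((v' w)⁻¹ * (v x - v' x)) • w := fun x => by simp [Q1]
  have hQ1v : ∀ x, v' (Q1 x) = v x := fun x => by
    rw [hQ1]; simp; field_simp; ring
  have hQ1i : Function.Injective Q1 := by
    rw [injective_iff_map_eq_zero]
    intro x hx
    have h1 : v x = 0 := by rw [← hQ1v, hx, map_zero]
    rw [hQ1] at hx
    have h2 : x = -(((v' w)⁻¹ * (v x - v' x)) • w) := eq_neg_of_add_eq_zero_left hx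
    have h3 := congrArg v h2
    rw [h1, map_neg, map_smul, smul_eq_mul, eq_comm, neg_eq_zero, mul_eq_zero,
      or_iff_left hw] at h3
    rw [h2, h1, h3]; simp
  -- second map
  have hu1 : Q1 u ≠ 0 := fun h => hu (hQ1i (by rw [h, map_zero]))
  have hu2 : c • u' ≠ 0 := smul_ne_zero hc hu'
  obtain ⟨f, hf1, hf2⟩ : ∃ f : Euc d →ₗ[ℝ] ℝ, f (Q1 u) ≠ 0 ∧ f (c • u') ≠ 0 := by
    obtain ⟨f1, h1⟩ := SeparatingDual.exists_ne_zero (R := ℝ) hu1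
    obtain ⟨f2, h2⟩ := SeparatingDual.exists_ne_zero (R := ℝ) hu2
    exact exists_ne_ne (f := LinearMap.applyₗ (Q1 u)) (g := LinearMap.applyₗ (c • u'))
      (fun h => h1 (by simpa using LinearMap.congr_fun h f1.toLinearMap))
      (fun h => h2 (by simpa using LinearMap.congr_fun h f2.toLinearMap))
  let Q2 : Euc d →ₗ[ℝ] Euc d := LinearMap.id + ((f (Q1 u))⁻¹ • f).smulRight (c • u' - Q1 u)
  have hQ2 : ∀ x, Q2 x = x + ((f (Q1 u))⁻¹ * f x) • (c • u' - Q1 u) := fun x => by simp [Q2]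
  have hQ2f : ∀ x, f (Q2 x) = (f (Q1 u))⁻¹ * f x * f (c • u') := fun x => by
    rw [hQ2, map_add, map_smul, map_sub, smul_eq_mul]; field_simp; ring
  refine ⟨Q2.comp Q1, c, ?_, hc, ?_, ?_⟩
  · refine Function.Injective.comp (g := Q2) ?_ hQ1i
    rw [injective_iff_map_eq_zero]
    intro x hx
    have h1 := hQ2f x
    rw [hx, map_zero, eq_comm, mul_eq_zero, or_iff_left hf2, mul_eq_zero,
      or_iff_right (inv_ne_zero hf1)] at h1
    rw [hQ2, h1] at hx
    simpa using hx
  · simp only [LinearMap.comp_apply]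
    rw [hQ2, inv_mul_cancel₀ hf1, one_smul]; abel
  · intro x
    simp only [LinearMap.comp_apply]
    rw [hQ2, map_add, map_smul, map_sub, hcv, hQ1v, hQ1v, sub_self, smul_zero, add_zero]

/-- A rank-one flow with `v u = 0` has no orbit accumulating at a fixed point, one with
`v u ≠ 0` does. -/
theorem rank_one_type {A B : Matrix (Fin d) (Fin d) ℝ} {h : Euc d ≃ₜ Euc d}
    (H : ORel (linFlow A) (linFlow B) h)
    {u u' : Euc d} {v v' : Euc d →ₗ[ℝ] ℝ} (hu : u ≠ 0) (hu' : u' ≠ 0)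
    (hv : v ≠ 0)
    (hA : ∀ x, Matrix.toEuclideanLin A x = v x • u)
    (hB : ∀ x, Matrix.toEuclideanLin B x = v' x • u')
    (h0 : v u = 0) : v' u' = 0 := by
  by_contra hne
  have hGA := goodFlow_linFlow A
  have hGB := goodFlow_linFlow B
  obtain ⟨x, hx⟩ : ∃ a, v a ≠ 0 := by
    by_contra h; push Not at h; exact hv (LinearMap.ext h)
  -- v is constant along orbits of A
  have hconst : ∀ t, v (linFlow A t x) = v x := by
    intro t
    have hd : ∀ t, HasDerivAt (fun t => v (linFlow A t x)) 0 t := fun t => by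
      have := (LinearMap.toContinuousLinearMap v).hasFDerivAt.comp_hasDerivAt t
        (linFlow_hasDerivAt A x t)
      rw [hA] at this
      simpa [h0, Function.comp_def] using this
    have := is_const_of_deriv_eq_zero (fun t => (hd t).differentiableAt)
      (fun t => (hd t).deriv) t 0
    simpa [linFlow_zero] using this
  -- B-orbit of h x accumulates at a fixed point
  set y := h x with hy
  set w : Euc d := (v' y / v' u') • u' with hw
  have hfix : IsFixedPt B (y - w) := by
    rw [isFixedPt_iff, hB, map_sub, hw, map_smul, smul_eq_mul, div_mul_cancel₀ _ hne, sub_self,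
      zero_smul]
  have hflow : ∀ t, linFlow B t y = (y - w) + Real.exp (v' u' * t) • w := by
    intro t
    have e : y = (y - w) + w := by abel
    conv_lhs => rw [e]
    rw [linFlow_map_add, hfix t, linFlow_eigen (c := v' u')]
    rw [hB, hw, map_smul, smul_eq_mul, smul_smul, mul_comm]
  obtain ⟨l, hl, hlim⟩ : ∃ l : Filter ℝ, l.NeBot ∧
      Tendsto (fun t => Real.exp (v' u' * t)) l (𝓝 0) := by
    rcases lt_or_gt_of_ne hne with hlt | hgt
    · exact ⟨atTop, inferInstance,
        Real.tendsto_exp_atBot.comp (tendsto_id.const_mul_atTop_of_neg hlt)⟩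
    · exact ⟨atBot, inferInstance,
        Real.tendsto_exp_atBot.comp (tendsto_id.const_mul_atBot hgt)⟩
  have hlim2 : Tendsto (fun t => linFlow B t y) l (𝓝 (y - w)) := by
    simp_rw [hflow]
    simpa using (hlim.smul_const w).const_add (y - w)
  have hvc : Continuous v := LinearMap.continuous_of_finiteDimensional v
  have hlim3 : Tendsto (fun t => v (h.symm (linFlow B t y))) l (𝓝 (v (h.symm (y - w)))) :=
    (hvc.tendsto _).comp ((h.symm.continuous.tendsto _).comp hlim2)
  have hc : ∀ t, v (h.symm (linFlow B t y)) = v x := fun t => by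
    obtain ⟨s, hs⟩ := H.symm.exists t y
    rw [hs, hy, h.symm_apply_apply, hconst]
  simp_rw [hc] at hlim3
  have e1 : v x = v (h.symm (y - w)) := tendsto_nhds_unique tendsto_const_nhds hlim3
  have e2 : IsFixedPt A (h.symm (y - w)) := H.symm.fixed hfix
  rw [isFixedPt_iff, hA, smul_eq_zero, or_iff_left hu] at e2
  exact hx (e1.trans e2)

theorem nonfixed_preconnected_of {A B : Matrix (Fin d) (Fin d) ℝ} {h : Euc d ≃ₜ Euc d}
    (H : ORel (linFlow A) (linFlow B) h)
    (hB : IsPreconnected {x | ¬ ∀ t, linFlow B t x = x}) :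
    IsPreconnected {x | ¬ ∀ t, linFlow A t x = x} := by
  have : {x | ¬ ∀ t, linFlow A t x = x} = h.symm '' {x | ¬ ∀ t, linFlow B t x = x} := by
    ext x
    rw [← h.symm.preimage_symm]
    simp only [Set.mem_preimage, Set.mem_ofPred_eq, Homeomorph.symm_symm]
    exact not_congr (H.fixed_iff).symm
  rw [this]
  exact hB.image _ h.symm.continuous.continuousOn

/-- **Proposition 3.1**: for linear flows and each of the six regularity classes
`⋆ ∈ {0, 0⁺, 1⁻, 1, diff, lin}`, strict `⋆`-equivalence coincides with `⋆`-equivalence. -/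
theorem strictEquiv_iff_equiv {d : ℕ} (A B : Matrix (Fin d) (Fin d) ℝ)
    (P : (Euc d ≃ₜ Euc d) → Prop)
    (hP : P = @MemH0 d ∨ P = @MemH0plus d ∨ P = @MemH1minus d ∨ P = @MemH1 d ∨
      P = @MemHdiff d ∨ P = @MemHlin d) :
    StrictRelEquivWith P A B ↔ RelEquivWith P A B := by
  constructor
  · rintro ⟨h, hPh, hO, -⟩
    exact ⟨h, hPh, hO⟩
  · rintro ⟨h, hPh, hO⟩
    have H : ORel (linFlow A) (linFlow B) h := hO
    have hpre : IsPreconnected {x | ¬ ∀ t, linFlow A t x = x} → StrictRelEquivWith P A B :=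
      fun hc => ⟨h, hPh, hO, sign_const (goodFlow_linFlow A) (goodFlow_linFlow B) H hc⟩
    rcases preconnected_or_rank_one A with hA | ⟨u, v, hu, hv, hA⟩
    · exact hpre hA
    rcases preconnected_or_rank_one B with hB | ⟨u', v', hu', hv', hB⟩
    · exact hpre (nonfixed_preconnected_of H hB)
    have hz : v u = 0 ↔ v' u' = 0 :=
      ⟨rank_one_type H hu hu' hv hA hB, rank_one_type H.symm hu' hu hv' hB hA⟩
    obtain ⟨Q, c, hinj, hc, hQu, hQv⟩ := exists_conj hu hu' hv hv' hz
    refine strict_of_linear P hP Q hinj hc fun x => ?_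
    rw [hA, hB, map_smul, hQu, hQv, smul_smul, smul_smul, mul_comm]

end LF
end
end

section
/- Let m ∈ ℕ and a ∈ ℝ∖{0}, and let Φ, Ψ be the linear flows on ℝ^m generated by J_m(a) and by aI_m, respectively. Then Φ and Ψ are all-Hölder equivalent (Φ ~^{1⁻} Ψ); in fact there exists h ∈ 𝓗_{1⁻}(ℝ^m) with h(Ψ_t x) = Φ_t h(x) for all t ∈ ℝ and x ∈ ℝ^m (all-Hölder conjugacy). -/
noncomputable section
namespace LF

open Filter Topology

variable {d : ℕ}

section Abs
variable {E : Type*} [NormedAddCommGroup E] [NormedSpace ℝ E] (G : ℝ → E →ₗ[ℝ] E)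

def twist (x : E) : E := G (Real.log ‖x‖) x

variable {G}

theorem twist_zero : twist G 0 = 0 := by simp [twist]

theorem G_zero (h1 : ∀ s x, ‖G s x - x‖ ≤ (Real.exp (|s| / 2) - 1) * ‖x‖) (x : E) :
    G 0 x = x := by
  have := h1 0 x
  simp at this
  exact sub_eq_zero.mp this

theorem G_bound (h1 : ∀ s x, ‖G s x - x‖ ≤ (Real.exp (|s| / 2) - 1) * ‖x‖) (s : ℝ) (x : E) :
    ‖G s x‖ ≤ Real.exp (|s| / 2) * ‖x‖ := by
  have := h1 s x
  have h2 := norm_sub_norm_le (G s x) x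
  nlinarith

theorem key (h1 : ∀ s x, ‖G s x - x‖ ≤ (Real.exp (|s| / 2) - 1) * ‖x‖) {x w : E}
    (h : ‖x‖ ≤ ‖w‖) : ‖G (Real.log ‖x‖ - Real.log ‖w‖) x - x‖ ≤ ‖x - w‖ / 2 := by
  rcases eq_or_ne x 0 with rfl | hx
  · simp only [map_zero, sub_zero, norm_zero]; positivity
  have hx' : 0 < ‖x‖ := norm_pos_iff.mpr hx
  have hw' : 0 < ‖w‖ := hx'.trans_le h
  have hl : Real.log ‖x‖ ≤ Real.log ‖w‖ := Real.log_le_log hx' h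
  have h2 := h1 (Real.log ‖x‖ - Real.log ‖w‖) x
  rw [abs_of_nonpos (by linarith)] at h2
  set e := Real.exp (-(Real.log ‖x‖ - Real.log ‖w‖) / 2) with he
  have h3 : e * e * ‖x‖ = ‖w‖ := by
    rw [he, ← Real.exp_add]
    nth_rw 3 [← Real.exp_log hx']
    rw [← Real.exp_add]
    conv_rhs => rw [← Real.exp_log hw']
    congr 1; ring
  have h4 := norm_sub_norm_le w x
  rw [norm_sub_rev] at h4
  nlinarith [mul_nonneg (sq_nonneg (e - 1)) hx'.le]

theorem ident (hadd : ∀ s t x, G (s + t) x = G s (G t x))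
    (h1 : ∀ s x, ‖G s x - x‖ ≤ (Real.exp (|s| / 2) - 1) * ‖x‖) (x w : E) :
    G (-Real.log ‖w‖) (twist G x - twist G w) = G (Real.log ‖x‖ - Real.log ‖w‖) x - w := by
  rw [map_sub, twist, twist, ← hadd, ← hadd, neg_add_cancel, G_zero h1]
  congr 3; ring

theorem est2 (hadd : ∀ s t x, G (s + t) x = G s (G t x))
    (h1 : ∀ s x, ‖G s x - x‖ ≤ (Real.exp (|s| / 2) - 1) * ‖x‖) {x w : E}
    (h : ‖x‖ ≤ ‖w‖) {B : ℝ} (hB : ∀ z, ‖G (-Real.log ‖w‖) z‖ ≤ B * ‖z‖) :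
    ‖x - w‖ ≤ 2 * B * ‖twist G x - twist G w‖ := by
  have h2 := hB (twist G x - twist G w)
  rw [ident hadd h1] at h2
  have h3 := key h1 h
  have h4 := norm_sub_le (G (Real.log ‖x‖ - Real.log ‖w‖) x - w) (G (Real.log ‖x‖ - Real.log ‖w‖) x - x)
  rw [sub_sub_sub_cancel_left] at h4
  linarith

theorem est1 (hadd : ∀ s t x, G (s + t) x = G s (G t x))
    (h1 : ∀ s x, ‖G s x - x‖ ≤ (Real.exp (|s| / 2) - 1) * ‖x‖) {x w : E}
    (h : ‖x‖ ≤ ‖w‖) {B : ℝ} (hB0 : 0 ≤ B) (hB : ∀ z, ‖G (Real.log ‖w‖) z‖ ≤ B * ‖z‖) :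
    ‖twist G x - twist G w‖ ≤ 2 * B * ‖x - w‖ := by
  have h2 := hB (G (-Real.log ‖w‖) (twist G x - twist G w))
  rw [← hadd, add_neg_cancel, G_zero h1, ident hadd h1] at h2
  have h3 := key h1 h
  have h4 := norm_add_le (x - w) (G (Real.log ‖x‖ - Real.log ‖w‖) x - x)
  rw [sub_add_sub_cancel'] at h4
  have h5 := norm_nonneg (x - w)
  nlinarith

theorem both (hadd : ∀ s t x, G (s + t) x = G s (G t x))
    (h1 : ∀ s x, ‖G s x - x‖ ≤ (Real.exp (|s| / 2) - 1) * ‖x‖)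
    (hε : ∀ ε > 0, ∃ C > 0, ∀ s x, ‖G s x‖ ≤ C * Real.exp (ε * |s|) * ‖x‖)
    {ε : ℝ} (he : 0 < ε) (R : ℝ) (hR : 1 ≤ R) :
    ∃ K > 0, ∀ x w : E, ‖x‖ ≤ R → ‖w‖ ≤ R → x ≠ w →
      ‖twist G x - twist G w‖ ≤ K * ‖x - w‖ ^ (-ε) * ‖x - w‖ ∧
      ‖x - w‖ ≤ K * ‖x - w‖ ^ (-ε) * ‖twist G x - twist G w‖ := by
  obtain ⟨C, hC, hG⟩ := hε ε he
  refine ⟨2 * (C * (Real.exp (ε * (2 * Real.log R)) * 2 ^ ε)), by positivity, ?_⟩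
  have main : ∀ x w : E, ‖x‖ ≤ ‖w‖ → ‖w‖ ≤ R → x ≠ w →
      C * Real.exp (ε * |Real.log ‖w‖|) ≤
        C * (Real.exp (ε * (2 * Real.log R)) * 2 ^ ε) * ‖x - w‖ ^ (-ε) := by
    intro x w h hw hne
    have hd : 0 < ‖x - w‖ := norm_pos_iff.mpr (sub_ne_zero.mpr hne)
    have hd2 : ‖x - w‖ ≤ 2 * ‖w‖ := by linarith [norm_sub_le x w]
    have hw0 : 0 < ‖w‖ := by linarith
    have hl1 : Real.log ‖w‖ ≤ Real.log R := Real.log_le_log hw0 hw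
    have hl2 : 0 ≤ Real.log R := Real.log_nonneg hR
    have hl3 : Real.log ‖x - w‖ ≤ Real.log 2 + Real.log ‖w‖ := by
      rw [← Real.log_mul (by norm_num) hw0.ne']
      exact Real.log_le_log hd hd2
    rw [Real.rpow_def_of_pos hd, Real.rpow_def_of_pos (by norm_num : (0:ℝ) < 2), mul_assoc,
      ← Real.exp_add, ← Real.exp_add]
    gcongr
    have : |Real.log ‖w‖| ≤ 2 * Real.log R - Real.log ‖w‖ := abs_le.mpr ⟨by linarith, by linarith⟩
    nlinarith
  have main2 : ∀ x w : E, ‖x‖ ≤ ‖w‖ → ‖w‖ ≤ R → x ≠ w →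
      ‖twist G x - twist G w‖ ≤ 2 * (C * (Real.exp (ε * (2 * Real.log R)) * 2 ^ ε)) * ‖x - w‖ ^ (-ε) * ‖x - w‖ ∧
      ‖x - w‖ ≤ 2 * (C * (Real.exp (ε * (2 * Real.log R)) * 2 ^ ε)) * ‖x - w‖ ^ (-ε) * ‖twist G x - twist G w‖ := by
    intro x w h hw hne
    have hm := main x w h hw hne
    constructor
    · refine (est1 hadd h1 h (by positivity) (hG _)).trans ?_
      rw [mul_assoc 2 _ (‖x - w‖ ^ (-ε))]
      gcongr
    · refine (est2 hadd h1 h (fun z => hG _ z)).trans ?_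
      rw [abs_neg, mul_assoc 2 _ (‖x - w‖ ^ (-ε))]
      gcongr
  intro x w hx hw hne
  rcases le_total ‖x‖ ‖w‖ with h | h
  · exact main2 x w h hw hne
  · have := main2 w x h hx hne.symm
    rwa [norm_sub_rev w x, norm_sub_rev (twist G w)] at this

theorem hold1 (hadd : ∀ s t x, G (s + t) x = G s (G t x))
    (h1 : ∀ s x, ‖G s x - x‖ ≤ (Real.exp (|s| / 2) - 1) * ‖x‖)
    (hε : ∀ ε > 0, ∃ C > 0, ∀ s x, ‖G s x‖ ≤ C * Real.exp (ε * |s|) * ‖x‖)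
    {γ : ℝ} (hγ : 0 < γ) (hγ1 : γ < 1) (R : ℝ) (hR : 1 ≤ R) :
    ∃ K ≥ 0, ∀ x w : E, ‖x‖ ≤ R → ‖w‖ ≤ R →
      ‖twist G x - twist G w‖ ≤ K * ‖x - w‖ ^ γ := by
  obtain ⟨K, hK, h⟩ := both hadd h1 hε (ε := 1 - γ) (by linarith) R hR
  refine ⟨K, hK.le, fun x w hx hw => ?_⟩
  rcases eq_or_ne x w with rfl | hne
  · simp only [sub_self, norm_zero]; positivity
  have hd : 0 < ‖x - w‖ := norm_pos_iff.mpr (sub_ne_zero.mpr hne)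
  refine (h x w hx hw hne).1.trans_eq ?_
  rw [mul_assoc, ← Real.rpow_add_one hd.ne']
  congr 2; ring

theorem hold2 (hadd : ∀ s t x, G (s + t) x = G s (G t x))
    (h1 : ∀ s x, ‖G s x - x‖ ≤ (Real.exp (|s| / 2) - 1) * ‖x‖)
    (hε : ∀ ε > 0, ∃ C > 0, ∀ s x, ‖G s x‖ ≤ C * Real.exp (ε * |s|) * ‖x‖)
    {γ : ℝ} (hγ : 0 < γ) (hγ1 : γ < 1) (R : ℝ) (hR : 1 ≤ R) :
    ∃ K ≥ 0, ∀ x w : E, ‖x‖ ≤ R → ‖w‖ ≤ R →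
      ‖x - w‖ ≤ K * ‖twist G x - twist G w‖ ^ γ := by
  have hg : 1 < 1 / γ := by rw [lt_div_iff₀ hγ]; linarith
  obtain ⟨K, hK, h⟩ := both hadd h1 hε (ε := 1 / γ - 1) (by linarith) R hR
  refine ⟨K ^ γ, by positivity, fun x w hx hw => ?_⟩
  rcases eq_or_ne x w with rfl | hne
  · simp only [sub_self, norm_zero]; positivity
  have hd : 0 < ‖x - w‖ := norm_pos_iff.mpr (sub_ne_zero.mpr hne)
  have h2 := (h x w hx hw hne).2
  have h3 : ‖x - w‖ ^ (1 / γ) ≤ K * ‖twist G x - twist G w‖ := by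
    have h5 : ‖x - w‖ ^ (1 / γ) = ‖x - w‖ ^ (1 / γ - 1) * ‖x - w‖ := by
      rw [← Real.rpow_add_one hd.ne']; congr 1; ring
    have h6 : ‖x - w‖ ^ (1 / γ - 1) * ‖x - w‖ ^ (-(1 / γ - 1)) = 1 := by
      rw [← Real.rpow_add hd, add_neg_cancel, Real.rpow_zero]
    rw [h5]
    calc _ ≤ ‖x - w‖ ^ (1 / γ - 1) * (K * ‖x - w‖ ^ (-(1 / γ - 1)) * ‖twist G x - twist G w‖) := by
          gcongr
      _ = (‖x - w‖ ^ (1 / γ - 1) * ‖x - w‖ ^ (-(1 / γ - 1))) * (K * ‖twist G x - twist G w‖) := by ring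
      _ = _ := by rw [h6, one_mul]
  have h4 := Real.rpow_le_rpow (by positivity) h3 hγ.le
  rwa [← Real.rpow_mul hd.le, one_div_mul_cancel hγ.ne', Real.rpow_one,
    Real.mul_rpow hK.le (norm_nonneg _)] at h4

theorem proper (hadd : ∀ s t x, G (s + t) x = G s (G t x))
    (h1 : ∀ s x, ‖G s x - x‖ ≤ (Real.exp (|s| / 2) - 1) * ‖x‖) (x : E) :
    ‖x‖ ≤ 1 + ‖twist G x‖ ^ 2 := by
  rcases le_total ‖x‖ 1 with h | h
  · nlinarith [sq_nonneg ‖twist G x‖]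
  have hx : 0 < ‖x‖ := by linarith
  have h2 := G_bound h1 (-Real.log ‖x‖) (twist G x)
  rw [twist, ← hadd, neg_add_cancel, G_zero h1, abs_neg, abs_of_nonneg (Real.log_nonneg h),
    ← twist] at h2
  set e := Real.exp (Real.log ‖x‖ / 2) with he
  have h3 : e * e = ‖x‖ := by
    rw [he, ← Real.exp_add, add_halves, Real.exp_log hx]
  have h0 : 0 < e := Real.exp_pos _
  have : e ≤ ‖twist G x‖ := by
    rw [← h3] at h2
    exact le_of_mul_le_mul_left h2 h0
  nlinarith

theorem twist_surj (hadd : ∀ s t x, G (s + t) x = G s (G t x))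
    (h1 : ∀ s x, ‖G s x - x‖ ≤ (Real.exp (|s| / 2) - 1) * ‖x‖)
    (hc : ∀ x, Continuous fun s => G s x) (y : E) : ∃ x, twist G x = y := by
  rcases eq_or_ne y 0 with rfl | hy
  · exact ⟨0, twist_zero⟩
  have hy' : 0 < ‖y‖ := norm_pos_iff.mpr hy
  have hF : Continuous fun s : ℝ => Real.exp (-s) * ‖G (-s) y‖ := by
    have : Continuous fun s : ℝ => G (-s) y := (hc y).comp continuous_neg
    fun_prop
  have hle : ∀ s : ℝ, 0 ≤ s → Real.exp (-s) * ‖G (-s) y‖ ≤ Real.exp (-s / 2) * ‖y‖ := by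
    intro s hs
    have := G_bound h1 (-s) y
    rw [abs_neg, abs_of_nonneg hs] at this
    calc _ ≤ Real.exp (-s) * (Real.exp (s / 2) * ‖y‖) := by gcongr
      _ = _ := by rw [← mul_assoc, ← Real.exp_add]; congr 2; ring
  have hge : ∀ s : ℝ, s ≤ 0 → Real.exp (-s / 2) * ‖y‖ ≤ Real.exp (-s) * ‖G (-s) y‖ := by
    intro s hs
    have := G_bound h1 s (G (-s) y)
    rw [← hadd, add_neg_cancel, G_zero h1, abs_of_nonpos hs] at this
    calc _ ≤ Real.exp (-s / 2) * (Real.exp (-s / 2) * ‖G (-s) y‖) := by gcongr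
      _ = _ := by rw [← mul_assoc, ← Real.exp_add]; congr 2; ring
  obtain ⟨s, hs⟩ := mem_range_of_exists_le_of_exists_ge (c := (1 : ℝ)) hF
    ⟨2 * |Real.log ‖y‖|, (hle _ (by positivity)).trans (by
      nth_rw 2 [← Real.exp_log hy']
      rw [← Real.exp_add, Real.exp_le_one_iff]
      linarith [le_abs_self (Real.log ‖y‖)])⟩
    ⟨-(2 * |Real.log ‖y‖|), le_trans (by
      nth_rw 2 [← Real.exp_log hy']
      rw [← Real.exp_add, Real.one_le_exp_iff]
      linarith [neg_abs_le (Real.log ‖y‖)]) (hge _ (by simp))⟩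
  have hs2 : ‖G (-s) y‖ = Real.exp s := by
    have : Real.exp s * (Real.exp (-s) * ‖G (-s) y‖) = Real.exp s := by
      simp only at hs
      rw [hs, mul_one]
    rwa [← mul_assoc, ← Real.exp_add, add_neg_cancel, Real.exp_zero, one_mul] at this
  refine ⟨G (-s) y, ?_⟩
  rw [twist, hs2, Real.log_exp, ← hadd, add_neg_cancel, G_zero h1]

/-- continuity from local uniform Hölder bounds -/
theorem cont_of_holder {f : E → E} (h : ∀ R : ℝ, 1 ≤ R → ∃ K : ℝ, ∀ x w : E, ‖x‖ ≤ R → ‖w‖ ≤ R →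
    ‖f x - f w‖ ≤ K * ‖x - w‖ ^ (1 / 2 : ℝ)) : Continuous f := by
  rw [continuous_iff_continuousAt]
  intro w
  obtain ⟨K, hK⟩ := h (‖w‖ + 1) (by linarith [norm_nonneg w])
  rw [ContinuousAt, tendsto_iff_norm_sub_tendsto_zero]
  have h2 : Filter.Tendsto (fun x => K * ‖x - w‖ ^ (1 / 2 : ℝ)) (nhds w) (nhds 0) := by
    have : Continuous fun x : E => K * ‖x - w‖ ^ (1 / 2 : ℝ) := by
      refine continuous_const.mul (Continuous.rpow_const (by fun_prop) ?_)
      intro x; right; norm_num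
    have h3 := this.tendsto w
    simpa using h3
  refine squeeze_zero' (Filter.Eventually.of_forall fun _ => norm_nonneg _) ?_ h2
  filter_upwards [Metric.ball_mem_nhds w one_pos] with x hx
  refine hK x w ?_ (by linarith)
  rw [mem_ball_iff_norm] at hx
  linarith [norm_sub_norm_le x w]

theorem exists_homeo (hadd : ∀ s t x, G (s + t) x = G s (G t x))
    (h1 : ∀ s x, ‖G s x - x‖ ≤ (Real.exp (|s| / 2) - 1) * ‖x‖)
    (hε : ∀ ε > 0, ∃ C > 0, ∀ s x, ‖G s x‖ ≤ C * Real.exp (ε * |s|) * ‖x‖)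
    (hc : ∀ x, Continuous fun s => G s x) :
    ∃ h : E ≃ₜ E, (∀ x, h x = twist G x) ∧
      (∀ γ : ℝ, 0 < γ → γ < 1 → ∀ R : ℝ, 1 ≤ R → ∃ K ≥ 0, ∀ x w, ‖x‖ ≤ R → ‖w‖ ≤ R →
        ‖h x - h w‖ ≤ K * ‖x - w‖ ^ γ) ∧
      (∀ γ : ℝ, 0 < γ → γ < 1 → ∀ R : ℝ, 1 ≤ R → ∃ K ≥ 0, ∀ x w, ‖x‖ ≤ R → ‖w‖ ≤ R →
        ‖h.symm x - h.symm w‖ ≤ K * ‖x - w‖ ^ γ) := by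
  have hinj : Function.Injective (twist G) := by
    intro x w hxw
    obtain ⟨K, -, h⟩ := hold2 hadd h1 hε (γ := 1 / 2) (by norm_num) (by norm_num)
      (1 + ‖x‖ + ‖w‖) (by linarith [norm_nonneg x, norm_nonneg w])
    have := h x w (by linarith [norm_nonneg w]) (by linarith [norm_nonneg x])
    rw [hxw, sub_self, norm_zero, Real.zero_rpow (by norm_num), mul_zero] at this
    exact sub_eq_zero.mp (norm_le_zero_iff.mp this)
  let e : E ≃ E := Equiv.ofBijective (twist G) ⟨hinj, twist_surj hadd h1 hc⟩
  have hs : ∀ y, twist G (e.symm y) = y := fun y => e.apply_symm_apply y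
  have hinv : ∀ γ : ℝ, 0 < γ → γ < 1 → ∀ R : ℝ, 1 ≤ R → ∃ K ≥ 0, ∀ x w, ‖x‖ ≤ R → ‖w‖ ≤ R →
        ‖e.symm x - e.symm w‖ ≤ K * ‖x - w‖ ^ γ := by
    intro γ h0 h2 R hR
    obtain ⟨K, hK, h⟩ := hold2 hadd h1 hε h0 h2 (1 + R ^ 2) (by nlinarith)
    refine ⟨K, hK, fun x w hx hw => ?_⟩
    have aux : ∀ x, ‖x‖ ≤ R → ‖e.symm x‖ ≤ 1 + R ^ 2 := by
      intro x hx
      have := proper hadd h1 (e.symm x)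
      rw [hs] at this
      refine this.trans ?_
      gcongr
    have := h _ _ (aux x hx) (aux w hw)
    rwa [hs, hs] at this
  refine ⟨⟨e, ?_, ?_⟩, fun x => rfl, fun γ h0 h2 R hR => hold1 hadd h1 hε h0 h2 R hR, hinv⟩
  · refine cont_of_holder fun R hR => ?_
    obtain ⟨K, -, h⟩ := hold1 hadd h1 hε (γ := 1 / 2) (by norm_num) (by norm_num) R hR
    exact ⟨K, h⟩
  · refine cont_of_holder fun R hR => ?_
    obtain ⟨K, -, h⟩ := hinv (1 / 2) (by norm_num) (by norm_num) R hR
    exact ⟨K, h⟩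
end Abs

section Mat
open scoped Matrix.Norms.L2Operator

theorem norm_exp_sub_one_le' {m : ℕ} (A : Matrix (Fin m) (Fin m) ℝ) :
    ‖NormedSpace.exp A - 1‖ ≤ Real.exp ‖A‖ - 1 := by
  have h1 := NormedSpace.exp_series_hasSum_exp' (𝕂 := ℝ) A
  have h2 := NormedSpace.exp_series_hasSum_exp' (𝕂 := ℝ) ‖A‖
  rw [← Real.exp_eq_exp_ℝ] at h2
  rw [← hasSum_nat_add_iff' 1] at h1 h2
  simp only [Finset.sum_range_one, Nat.factorial_zero, Nat.cast_one, inv_one, pow_zero, one_smul]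
    at h1 h2
  rw [← h1.tsum_eq]
  refine tsum_of_norm_bounded h2 fun n => ?_
  rw [norm_smul, smul_eq_mul, Real.norm_of_nonneg (by positivity)]
  gcongr
  exact norm_pow_le' A (Nat.succ_pos n)

theorem toE_mul {m : ℕ} (A B : Matrix (Fin m) (Fin m) ℝ) (x : Euc m) :
    Matrix.toEuclideanLin (A * B) x = Matrix.toEuclideanLin A (Matrix.toEuclideanLin B x) := by
  simp [Matrix.toLpLin_apply, Matrix.mulVec_mulVec]

theorem toE_one {m : ℕ} (x : Euc m) :
    Matrix.toEuclideanLin (1 : Matrix (Fin m) (Fin m) ℝ) x = x := by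
  simp [Matrix.toLpLin_apply]

theorem toE_norm {m : ℕ} (A : Matrix (Fin m) (Fin m) ℝ) (x : Euc m) :
    ‖Matrix.toEuclideanLin A x‖ ≤ ‖A‖ * ‖x‖ :=
  Matrix.l2_opNorm_mulVec A x

theorem semi_exp {m : ℕ} {x a b : Matrix (Fin m) (Fin m) ℝ} (h : SemiconjBy x a b) :
    SemiconjBy x (NormedSpace.exp a) (NormedSpace.exp b) := by
  letI : NormedAlgebra ℚ (Matrix (Fin m) (Fin m) ℝ) := NormedAlgebra.restrictScalars ℚ ℝ _
  exact h.exp_right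

theorem mat_exp_cont (m : ℕ) :
    Continuous (NormedSpace.exp : Matrix (Fin m) (Fin m) ℝ → Matrix (Fin m) (Fin m) ℝ) := by
  letI : NormedAlgebra ℚ (Matrix (Fin m) (Fin m) ℝ) := NormedAlgebra.restrictScalars ℚ ℝ _
  exact NormedSpace.exp_continuous

/-- diagonal scaling matrix -/
def Dg (m : ℕ) (δ : ℝ) : Matrix (Fin m) (Fin m) ℝ := Matrix.diagonal fun i => δ ^ (i : ℕ)

theorem Dg_mul_inv (m : ℕ) {δ : ℝ} (hδ : δ ≠ 0) : Dg m δ * Dg m δ⁻¹ = 1 := by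
  rw [Dg, Dg, Matrix.diagonal_mul_diagonal, ← Matrix.diagonal_one]
  congr 1; ext i
  rw [← mul_pow, mul_inv_cancel₀ hδ, one_pow]

theorem Dg_semi (m : ℕ) (δ : ℝ) : SemiconjBy (Dg m δ) (δ • jordanNil m) (jordanNil m) := by
  unfold SemiconjBy Dg
  ext i j
  rw [Matrix.diagonal_mul, Matrix.mul_diagonal]
  simp only [jordanNil, Matrix.smul_apply, Matrix.of_apply, smul_eq_mul]
  split_ifs with h
  · rw [← h]; ring
  · simp

theorem growth {m : ℕ} (c : ℝ) (ε : ℝ) (hε : 0 < ε) :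
    ∃ C > 0, ∀ (s : ℝ) (x : Euc m),
      ‖Matrix.toEuclideanLin (NormedSpace.exp (s • c • jordanNil m)) x‖
        ≤ C * Real.exp (ε * |s|) * ‖x‖ := by
  set ν := |c| * ‖jordanNil m‖ with hν
  have hν0 : 0 ≤ ν := by positivity
  set δ := ε / (ν + 1) with hδ
  have hδ0 : 0 < δ := by positivity
  have hδν : δ * ν ≤ ε := by
    rw [hδ, div_mul_eq_mul_div, div_le_iff₀ (by positivity)]
    nlinarith
  refine ⟨‖Dg m δ‖ * ‖Dg m δ⁻¹‖ * (1 + ‖(1 : Matrix (Fin m) (Fin m) ℝ)‖) + 1, by positivity, fun s x => ?_⟩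
  refine (toE_norm _ x).trans ?_
  gcongr
  have hs : SemiconjBy (Dg m δ) (s • c • δ • jordanNil m) (s • c • jordanNil m) := by
    have := Dg_semi m δ
    unfold SemiconjBy at this ⊢
    simp only [Matrix.mul_smul, Matrix.smul_mul] at this ⊢
    rw [this]
  have h2 : NormedSpace.exp (s • c • jordanNil m) =
      Dg m δ * NormedSpace.exp (s • c • δ • jordanNil m) * Dg m δ⁻¹ := by
    rw [(semi_exp hs).eq, mul_assoc, Dg_mul_inv m hδ0.ne', mul_one]
  set Q := s • c • δ • jordanNil m with hQ
  have hQn : ‖Q‖ ≤ ε * |s| := by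
    rw [hQ, norm_smul, norm_smul, norm_smul, Real.norm_eq_abs, Real.norm_eq_abs, Real.norm_eq_abs,
      abs_of_pos hδ0]
    calc _ = (δ * ν) * |s| := by rw [hν]; ring
      _ ≤ _ := by gcongr
  have hE : ‖NormedSpace.exp Q‖ ≤ (1 + ‖(1 : Matrix (Fin m) (Fin m) ℝ)‖) * Real.exp (ε * |s|) := by
    have h3 := norm_exp_sub_one_le' Q
    have h4 := norm_add_le (NormedSpace.exp Q - 1) 1
    rw [sub_add_cancel] at h4
    have h5 : Real.exp ‖Q‖ ≤ Real.exp (ε * |s|) := Real.exp_le_exp.mpr hQn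
    have h6 : 1 ≤ Real.exp (ε * |s|) := Real.one_le_exp (by positivity)
    nlinarith [norm_nonneg (1 : Matrix (Fin m) (Fin m) ℝ)]
  rw [h2]
  calc _ ≤ ‖Dg m δ‖ * ‖NormedSpace.exp Q‖ * ‖Dg m δ⁻¹‖ :=
        (norm_mul_le _ _).trans (by gcongr; exact norm_mul_le _ _)
    _ ≤ ‖Dg m δ‖ * ((1 + ‖(1 : Matrix (Fin m) (Fin m) ℝ)‖) * Real.exp (ε * |s|)) * ‖Dg m δ⁻¹‖ := by
        gcongr
    _ = (‖Dg m δ‖ * ‖Dg m δ⁻¹‖ * (1 + ‖(1 : Matrix (Fin m) (Fin m) ℝ)‖)) * Real.exp (ε * |s|) := by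
        ring
    _ ≤ _ := by gcongr; linarith

theorem linFlow_scalar {m : ℕ} (a t : ℝ) (B : Matrix (Fin m) (Fin m) ℝ) (x : Euc m) :
    linFlow (a • 1 + B) t x =
      Real.exp (t * a) • Matrix.toEuclideanLin (NormedSpace.exp (t • B)) x := by
  have h1 : NormedSpace.exp ((t * a) • (1 : Matrix (Fin m) (Fin m) ℝ)) = Real.exp (t * a) • 1 := by
    have := NormedSpace.algebraMap_exp_comm (𝕂 := ℝ) (𝔸 := Matrix (Fin m) (Fin m) ℝ) (t * a)
    rw [Algebra.algebraMap_eq_smul_one, Algebra.algebraMap_eq_smul_one, ← Real.exp_eq_exp_ℝ] at this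
    exact this.symm
  have hc : Commute ((t * a) • (1 : Matrix (Fin m) (Fin m) ℝ)) (t • B) :=
    (Commute.one_left _).smul_left _
  rw [linFlow, smul_add, smul_smul, Matrix.exp_add_of_commute _ _ hc, h1, smul_one_mul, map_smul]
  rfl

theorem linFlow_scalar' {m : ℕ} (a t : ℝ) (x : Euc m) :
    linFlow (a • (1 : Matrix (Fin m) (Fin m) ℝ)) t x = Real.exp (t * a) • x := by
  have := linFlow_scalar a t (0 : Matrix (Fin m) (Fin m) ℝ) x
  rw [add_zero, smul_zero, NormedSpace.exp_zero, toE_one] at this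
  exact this

theorem exists_conj_s5 {m : ℕ} (a : ℝ) (ha : a ≠ 0) :
    ∃ h : Euc m ≃ₜ Euc m, MemH1minus h ∧
      ∀ (t : ℝ) (x : Euc m),
        h (linFlow (a • (1 : Matrix (Fin m) (Fin m) ℝ)) t x)
          = linFlow (a • (1 : Matrix (Fin m) (Fin m) ℝ) + jordanNil m) t (h x) := by
  set δ := |a| / (2 * (‖jordanNil m‖ + 1)) with hδ
  have ha' : 0 < |a| := abs_pos.mpr ha
  have hδ0 : 0 < δ := by positivity
  set c := δ / a with hc
  have hcN : ‖c • jordanNil m‖ ≤ 1 / 2 := by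
    rw [norm_smul, hc, norm_div, Real.norm_eq_abs, Real.norm_eq_abs, abs_of_pos hδ0, hδ]
    rw [div_div, mul_comm (2 * (‖jordanNil m‖ + 1)), ← div_div, div_self ha'.ne', one_div_mul_eq_div,
      div_le_div_iff₀ (by positivity) (by norm_num)]
    linarith [norm_nonneg (jordanNil m)]
  let G : ℝ → Euc m →ₗ[ℝ] Euc m := fun s =>
    Matrix.toEuclideanLin (NormedSpace.exp (s • c • jordanNil m))
  have hadd : ∀ s t x, G (s + t) x = G s (G t x) := by
    intro s t x
    simp only [G]
    rw [← toE_mul, add_smul, Matrix.exp_add_of_commute]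
    exact ((Commute.refl _).smul_left _).smul_right _
  have h1 : ∀ s x, ‖G s x - x‖ ≤ (Real.exp (|s| / 2) - 1) * ‖x‖ := by
    intro s x
    have : G s x - x = Matrix.toEuclideanLin (NormedSpace.exp (s • c • jordanNil m) - 1) x := by
      rw [map_sub, LinearMap.sub_apply, toE_one]
    rw [this]
    refine (toE_norm _ x).trans ?_
    gcongr
    refine (norm_exp_sub_one_le' _).trans ?_
    gcongr
    rw [norm_smul, Real.norm_eq_abs]
    nlinarith [abs_nonneg s]
  have hcont : ∀ x, Continuous fun s => G s x := by
    intro x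
    have h2 : Continuous fun s : ℝ => NormedSpace.exp (s • c • jordanNil m) :=
      (mat_exp_cont m).comp (by fun_prop)
    have h3 : Continuous fun A : Matrix (Fin m) (Fin m) ℝ => Matrix.toEuclideanLin A x :=
      LinearMap.continuous_of_finiteDimensional
        ((LinearMap.applyₗ x).comp (Matrix.toEuclideanLin (𝕜 := ℝ) (m := Fin m) (n := Fin m)).toLinearMap)
    exact h3.comp h2
  obtain ⟨h, hh, hH, hHs⟩ := exists_homeo hadd h1 (growth c) hcont
  let D : Euc m ≃ₜ Euc m :=
    { toFun := fun x => Matrix.toEuclideanLin (Dg m δ) x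
      invFun := fun x => Matrix.toEuclideanLin (Dg m δ⁻¹) x
      left_inv := fun x => by
        have := Dg_mul_inv m (inv_ne_zero hδ0.ne')
        rw [inv_inv] at this
        simp only
        rw [← toE_mul, this, toE_one]
      right_inv := fun x => by
        simp only
        rw [← toE_mul, Dg_mul_inv m hδ0.ne', toE_one]
      continuous_toFun := LinearMap.continuous_of_finiteDimensional _
      continuous_invFun := LinearMap.continuous_of_finiteDimensional _ }
  have hD : ∀ x, D x = Matrix.toEuclideanLin (Dg m δ) x := fun _ => rfl
  have hDs : ∀ x, D.symm x = Matrix.toEuclideanLin (Dg m δ⁻¹) x := fun _ => rfl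
  refine ⟨h.trans D, ?_, ?_⟩
  · intro γ hγ hγ1
    refine ⟨?_, ?_, ?_⟩
    · rw [Homeomorph.trans_apply, hh, twist_zero, hD, map_zero]
    · obtain ⟨K, hK, hb⟩ := hH γ hγ hγ1 1 le_rfl
      refine ⟨1, one_pos, ‖Dg m δ‖ * K, fun x hx y hy => ?_⟩
      rw [mem_ball_zero_iff] at hx hy
      rw [Homeomorph.trans_apply, Homeomorph.trans_apply, hD, hD, dist_eq_norm, dist_eq_norm,
        ← map_sub, mul_assoc]
      refine (toE_norm _ _).trans ?_
      gcongr
      exact hb x y hx.le hy.le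
    · obtain ⟨K, hK, hb⟩ := hHs γ hγ hγ1 (1 + ‖Dg m δ⁻¹‖) (by linarith [norm_nonneg (Dg m δ⁻¹)])
      refine ⟨1, one_pos, K * ‖Dg m δ⁻¹‖ ^ γ, fun x hx y hy => ?_⟩
      rw [mem_ball_zero_iff] at hx hy
      have aux : ∀ x : Euc m, ‖x‖ < 1 → ‖Matrix.toEuclideanLin (Dg m δ⁻¹) x‖ ≤ 1 + ‖Dg m δ⁻¹‖ := by
        intro x hx
        refine (toE_norm _ _).trans ?_
        nlinarith [norm_nonneg (Dg m δ⁻¹)]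
      rw [Homeomorph.symm_trans_apply, Homeomorph.symm_trans_apply, hDs, hDs, dist_eq_norm,
        dist_eq_norm]
      refine (hb _ _ (aux x hx) (aux y hy)).trans ?_
      rw [← map_sub, mul_assoc, ← Real.mul_rpow (norm_nonneg _) (norm_nonneg _)]
      gcongr
      exact toE_norm _ _
  · intro t x
    rw [linFlow_scalar', linFlow_scalar, Homeomorph.trans_apply, Homeomorph.trans_apply, hh, hh,
      hD, hD]
    rcases eq_or_ne x 0 with rfl | hx
    · simp [twist_zero]
    have hx' : 0 < ‖x‖ := norm_pos_iff.mpr hx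
    have hs : SemiconjBy (Dg m δ) ((t * a) • c • jordanNil m) (t • jordanNil m) := by
      have := Dg_semi m δ
      unfold SemiconjBy at this ⊢
      rw [smul_smul, show t * a * c = t * δ by rw [hc]; field_simp, ← smul_smul,
        Matrix.mul_smul, this, Matrix.smul_mul]
    rw [← toE_mul, ← (semi_exp hs).eq, toE_mul, ← map_smul]
    congr 1
    change twist G _ = _ • G (t * a) (twist G x)
    rw [twist, twist, norm_smul, Real.norm_of_nonneg (Real.exp_pos _).le,
      Real.log_mul (Real.exp_pos _).ne' hx'.ne', Real.log_exp, map_smul, hadd]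

end Mat

/-- **Lemma 4.1**: the flows on `ℝ^m` generated by `J_m(a)` and by `a I_m` (`a ≠ 0`) are
all-Hölder equivalent; in fact all-Hölder conjugate via some `h ∈ 𝓗_{1⁻}` with
`h (Ψ_t x) = Φ_t (h x)`. -/
theorem jordan_allHolder_equiv_diagonal {m : ℕ} (hm : 0 < m) (a : ℝ) (ha : a ≠ 0) :
    RelEquivWith MemH1minus
      (a • (1 : Matrix (Fin m) (Fin m) ℝ) + jordanNil m)
      (a • (1 : Matrix (Fin m) (Fin m) ℝ)) ∧
    ∃ h : Euc m ≃ₜ Euc m, MemH1minus h ∧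
      ∀ (t : ℝ) (x : Euc m),
        h (linFlow (a • (1 : Matrix (Fin m) (Fin m) ℝ)) t x)
          = linFlow (a • (1 : Matrix (Fin m) (Fin m) ℝ) + jordanNil m) t (h x) := by
  obtain ⟨h, hm1, hc⟩ := exists_conj_s5 (m := m) a ha
  refine ⟨⟨h.symm, ?_, ?_⟩, h, hm1, hc⟩
  · intro γ h0 h1
    obtain ⟨hz, hb, hb'⟩ := hm1 γ h0 h1
    exact ⟨by rw [Homeomorph.symm_apply_eq, hz], hb', hb⟩
  · intro x
    unfold flowOrbit
    rw [← Set.range_comp]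
    congr 1
    funext t
    simp only [Function.comp]
    rw [Homeomorph.symm_apply_eq, hc, Homeomorph.apply_symm_apply]

end LF
end
end

section
/- Let a, b ∈ ℝ∖{0}, and let Φ, Ψ be the linear flows on ℝ² generated by J_1(a+ib) = [[a,−b],[b,a]] and by aI_2, respectively. Then Φ and Ψ are Lipschitz equivalent (Φ ~^{1} Ψ); in fact the map g : ℝ² → ℝ² given by g(0) = 0 and g(x) = R_{−b log|x|/a} x for x ≠ 0, where R_s is rotation by angle s, is a bi-Lipschitz homeomorphism fixing 0 with g(Φ_t x) = Ψ_t g(x) for all t ∈ ℝ, x ∈ ℝ² (Lipschitz conjugacy). -/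
noncomputable section
namespace LF

open Filter Topology

variable {d : ℕ}

/-- Rotation by angle `s`. -/
def rotMat2 (s : ℝ) : Matrix (Fin 2) (Fin 2) ℝ :=
  !![Real.cos s, -Real.sin s; Real.sin s, Real.cos s]

open Classical in
/-- The map `g(x) = R_{-b log|x|/a} x` (and `g 0 = 0`). -/
def gMap (a b : ℝ) (x : Euc 2) : Euc 2 :=
  if x = 0 then 0 else Matrix.toEuclideanLin (rotMat2 (-b * Real.log ‖x‖ / a)) x

lemma rot_apply0 (s : ℝ) (x : Euc 2) :
    (Matrix.toEuclideanLin (rotMat2 s) x) 0 = Real.cos s * x 0 - Real.sin s * x 1 := by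
  simp [Matrix.toLpLin_apply, rotMat2, dotProduct, Fin.sum_univ_two, sub_eq_add_neg]

lemma rot_apply1 (s : ℝ) (x : Euc 2) :
    (Matrix.toEuclideanLin (rotMat2 s) x) 1 = Real.sin s * x 0 + Real.cos s * x 1 := by
  simp [Matrix.toLpLin_apply, rotMat2, dotProduct, Fin.sum_univ_two]

lemma euc_ext {x y : Euc 2} (h0 : x 0 = y 0) (h1 : x 1 = y 1) : x = y := by
  ext i; fin_cases i
  · exact h0
  · exact h1

lemma norm_sq2 (x : Euc 2) : ‖x‖ ^ 2 = x 0 ^ 2 + x 1 ^ 2 := by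
  rw [EuclideanSpace.norm_sq_eq]; simp [Fin.sum_univ_two]

lemma norm_rot (s : ℝ) (x : Euc 2) : ‖Matrix.toEuclideanLin (rotMat2 s) x‖ = ‖x‖ := by
  rw [← sq_eq_sq₀ (norm_nonneg _) (norm_nonneg _), norm_sq2, norm_sq2, rot_apply0, rot_apply1]
  linear_combination (x 0 ^ 2 + x 1 ^ 2) * Real.sin_sq_add_cos_sq s

lemma rot_rot (s t : ℝ) (x : Euc 2) :
    Matrix.toEuclideanLin (rotMat2 s) (Matrix.toEuclideanLin (rotMat2 t) x)
      = Matrix.toEuclideanLin (rotMat2 (s + t)) x := by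
  apply euc_ext
  · simp only [rot_apply0, rot_apply1, Real.cos_add, Real.sin_add]; ring
  · simp only [rot_apply0, rot_apply1, Real.cos_add, Real.sin_add]; ring

lemma rot_zero (x : Euc 2) : Matrix.toEuclideanLin (rotMat2 0) x = x := by
  apply euc_ext
  · simp [rot_apply0]
  · simp [rot_apply1]

lemma rot_diff (s t : ℝ) (x : Euc 2) :
    ‖Matrix.toEuclideanLin (rotMat2 s) x - Matrix.toEuclideanLin (rotMat2 t) x‖
      ≤ |s - t| * ‖x‖ := by
  refine (sq_le_sq₀ (norm_nonneg _) (by positivity)).1 ?_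
  rw [norm_sq2, mul_pow, norm_sq2, sq_abs]
  simp only [PiLp.sub_apply, rot_apply0, rot_apply1]
  have h := Real.one_sub_sq_div_two_le_cos (x := s - t)
  rw [Real.cos_sub] at h
  have h1 := Real.sin_sq_add_cos_sq s
  have h2 := Real.sin_sq_add_cos_sq t
  have h3 : (Real.cos s - Real.cos t) ^ 2 + (Real.sin s - Real.sin t) ^ 2 ≤ (s - t) ^ 2 := by
    nlinarith
  calc _ = ((Real.cos s - Real.cos t) ^ 2 + (Real.sin s - Real.sin t) ^ 2)
        * (x 0 ^ 2 + x 1 ^ 2) := by ring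
    _ ≤ _ := by gcongr

/-- The map `x ↦ R_{c log|x|} x`. -/
def spin (c : ℝ) (x : Euc 2) : Euc 2 := Matrix.toEuclideanLin (rotMat2 (c * Real.log ‖x‖)) x

lemma norm_spin (c : ℝ) (x : Euc 2) : ‖spin c x‖ = ‖x‖ := norm_rot _ _

lemma spin_zero (c : ℝ) : spin c 0 = 0 := by simp [spin]

lemma spin_spin (c d : ℝ) (h : c + d = 0) (x : Euc 2) : spin c (spin d x) = x := by
  unfold spin
  rw [norm_rot, rot_rot, ← add_mul, h, zero_mul, rot_zero]

lemma spin_lip_aux (c : ℝ) (x y : Euc 2) (hxy : ‖y‖ ≤ ‖x‖) :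
    ‖spin c x - spin c y‖ ≤ (1 + |c|) * ‖x - y‖ := by
  rcases eq_or_ne y 0 with rfl | hy
  · rw [spin_zero, sub_zero, sub_zero, norm_spin]
    nlinarith [abs_nonneg c, norm_nonneg x]
  have hy' : 0 < ‖y‖ := norm_pos_iff.2 hy
  have hx' : 0 < ‖x‖ := hy'.trans_le hxy
  have e : spin c x - spin c y = Matrix.toEuclideanLin (rotMat2 (c * Real.log ‖x‖)) (x - y)
      + (Matrix.toEuclideanLin (rotMat2 (c * Real.log ‖x‖)) y
        - Matrix.toEuclideanLin (rotMat2 (c * Real.log ‖y‖)) y) := by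
    unfold spin; rw [map_sub]; abel
  rw [e]
  refine (norm_add_le _ _).trans ?_
  rw [norm_rot, add_mul, one_mul]
  gcongr
  refine (rot_diff _ _ _).trans ?_
  rw [← mul_sub, abs_mul, mul_assoc]
  gcongr
  rw [abs_of_nonneg (sub_nonneg.2 (Real.log_le_log hy' hxy)), ← Real.log_div hx'.ne' hy'.ne']
  have := Real.log_le_sub_one_of_pos (div_pos hx' hy')
  calc _ ≤ (‖x‖ / ‖y‖ - 1) * ‖y‖ := by gcongr
    _ = ‖x‖ - ‖y‖ := by field_simp
    _ ≤ _ := norm_sub_norm_le _ _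

lemma spin_lip (c : ℝ) : LipschitzWith (Real.toNNReal (1 + |c|)) (spin c) := by
  apply LipschitzWith.of_dist_le_mul
  intro x y
  rw [Real.coe_toNNReal _ (by positivity), dist_eq_norm, dist_eq_norm]
  rcases le_total ‖y‖ ‖x‖ with h | h
  · exact spin_lip_aux c x y h
  · rw [norm_sub_rev, norm_sub_rev x]; exact spin_lip_aux c y x h

/-- `spin c` as a homeomorphism. -/
def spinHomeo (c : ℝ) : Euc 2 ≃ₜ Euc 2 where
  toFun := spin c
  invFun := spin (-c)
  left_inv := spin_spin _ _ (by ring)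
  right_inv := spin_spin _ _ (by ring)
  continuous_toFun := (spin_lip c).continuous
  continuous_invFun := (spin_lip (-c)).continuous

lemma exp_rot (a b t : ℝ) : NormedSpace.exp (t • !![a, -b; b, a])
    = Real.exp (t * a) • rotMat2 (t * b) := by
  have hc : Continuous (Algebra.leftMulMatrix Complex.basisOneI) :=
    LinearMap.continuous_of_finiteDimensional
      (Algebra.leftMulMatrix Complex.basisOneI).toLinearMap
  letI : NormedRing (Matrix (Fin 2) (Fin 2) ℝ) := Matrix.linftyOpNormedRing
  letI : NormedAlgebra ℝ (Matrix (Fin 2) (Fin 2) ℝ) := Matrix.linftyOpNormedAlgebra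
  have h := NormedSpace.map_exp (Algebra.leftMulMatrix Complex.basisOneI) hc
    (⟨t * a, t * b⟩ : ℂ)
  rw [Algebra.leftMulMatrix_complex, Algebra.leftMulMatrix_complex, ← Complex.exp_eq_exp_ℂ] at h
  have e : t • !![a, -b; b, a] = !![t * a, -(t * b); t * b, t * a] := by
    ext i j; fin_cases i <;> fin_cases j <;> simp
  rw [e]
  refine h.symm.trans ?_
  ext i j; fin_cases i <;> fin_cases j <;> simp [rotMat2, Complex.exp_re, Complex.exp_im]

lemma linFlow_rot (a b t : ℝ) (x : Euc 2) : linFlow !![a, -b; b, a] t x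
    = Real.exp (t * a) • Matrix.toEuclideanLin (rotMat2 (t * b)) x := by
  rw [linFlow, exp_rot, map_smul, LinearMap.smul_apply]

lemma linFlow_diag (a t : ℝ) (x : Euc 2) : linFlow (a • (1 : Matrix (Fin 2) (Fin 2) ℝ)) t x
    = Real.exp (t * a) • x := by
  have e : a • (1 : Matrix (Fin 2) (Fin 2) ℝ) = !![a, -0; 0, a] := by
    ext i j; fin_cases i <;> fin_cases j <;> simp
  rw [e, linFlow_rot, mul_zero, rot_zero]

lemma spin_conj (a b : ℝ) (ha : a ≠ 0) (t : ℝ) (x : Euc 2) :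
    spin (-b / a) (linFlow !![a, -b; b, a] t x)
      = linFlow (a • (1 : Matrix (Fin 2) (Fin 2) ℝ)) t (spin (-b / a) x) := by
  rcases eq_or_ne x 0 with rfl | hx
  · simp [linFlow, spin]
  have hx' : ‖x‖ ≠ 0 := norm_ne_zero_iff.2 hx
  rw [linFlow_rot, linFlow_diag]
  unfold spin
  rw [map_smul, rot_rot, norm_smul, norm_rot, Real.norm_eq_abs, Real.abs_exp,
    Real.log_mul (Real.exp_ne_zero _) hx', Real.log_exp]
  congr 4
  field_simp
  ring

lemma spin_eq_gMap (a b : ℝ) : spin (-b / a) = gMap a b := by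
  funext x
  unfold gMap
  split_ifs with h
  · rw [h, spin_zero]
  · unfold spin
    rw [div_mul_eq_mul_div]

lemma LipschitzWith_holder {f : Euc 2 → Euc 2} {K : NNReal} (h : LipschitzWith K f) :
    HolderNearZero 1 f :=
  ⟨1, one_pos, K, fun x _ y _ => by rw [Real.rpow_one]; exact h.dist_le_mul x y⟩

/-- **Lemma 4.3**: the flows on `ℝ²` generated by `J_1(a+ib) = [[a,-b],[b,a]]` and by
`a I_2` (`a, b ≠ 0`) are Lipschitz equivalent; in fact the map `g(x) = R_{-b log|x|/a} x`
is a bi-Lipschitz homeomorphism fixing `0` with `g (Φ_t x) = Ψ_t (g x)`. -/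
theorem rot_lipschitz_equiv_diagonal (a b : ℝ) (ha : a ≠ 0) (hb : b ≠ 0) :
    RelEquivWith (MemHolderClass 1) !![a, -b; b, a]
      (a • (1 : Matrix (Fin 2) (Fin 2) ℝ)) ∧
    ∃ h : Euc 2 ≃ₜ Euc 2, ⇑h = gMap a b ∧ h 0 = 0 ∧
      (∃ K : NNReal, LipschitzWith K ⇑h) ∧ (∃ K : NNReal, LipschitzWith K ⇑h.symm) ∧
      ∀ (t : ℝ) (x : Euc 2),
        h (linFlow !![a, -b; b, a] t x)
          = linFlow (a • (1 : Matrix (Fin 2) (Fin 2) ℝ)) t (h x) := by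
  refine ⟨⟨spinHomeo (-b / a), ⟨spin_zero _, LipschitzWith_holder (spin_lip _),
    LipschitzWith_holder (spin_lip _)⟩, ?_⟩, spinHomeo (-b / a), spin_eq_gMap a b, spin_zero _,
    ⟨_, spin_lip _⟩, ⟨_, spin_lip _⟩, spin_conj a b ha⟩
  intro x
  unfold flowOrbit
  rw [← Set.range_comp]
  congr 1
  funext t
  exact spin_conj a b ha t x

end LF
end
end
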